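/- arXiv:q-alg/9603010 — 3 statements merged into one kernel-verified Lean document; each statement's English description precedes it below -/
import Mathlib

section
/- Let φ : S¹ → ℝ³ be a smooth embedding and Γ a trivalent V-oriented Wilson graph with n external and t internal vertices and chosen edge orientations. On the configuration space C_{n,t}(φ), write ∧_{e ∈ E_Γ^{nW}} φ_e*ω = F · dμ, where dμ is the coordinate volume element determined by the orientation form Ω(Γ,or_Γ) (the product of the circle coordinates ds_1,…,ds_n and of Lebesgue measure on each ℝ³ factor, with the sign prescribed by Ω(Γ,or_Γ)). Then F is Lebesgue-integrable on C_{n,t}(φ); in particular, the configuration-space integral I(Γ)(φ) = ∫_{C_{n,t}(φ)} F dμ is a well-defined finite real number. -/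
/- ## Core: labelled Wilson diagrams (trivalent or with one 4-valent vertex),
   encoded by an "anchor" equivalence between edge-slots and vertex/component
   coordinates.  External vertices are labelled `Fin n` cyclically along the
   oriented Wilson line, internal vertices by `Fin t`.  Only non-Wilson edges
   are recorded (Wilson edges are the implicit arcs between consecutive
   external labels).  The anchor encodes both the valences and a representative
   of the vertex orientation (V-orientation). -/

noncomputable section

open scoped BigOperators

/-- slot-count of a trivalent Wilson graph: each external vertex carries one
non-Wilson edge-end, each internal vertex three. -/
def triBound (n t : ℕ) : Fin n ⊕ Fin t → ℕ := fun v =>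
  match v with
  | .inl _ => 1
  | .inr _ => 3

/-- slot-count of a Wilson graph with a single 4-valent vertex `m`
(all other vertices trivalent). -/
def quadBound (n t : ℕ) (m : Fin n ⊕ Fin t) : Fin n ⊕ Fin t → ℕ := fun v =>
  if v = m then (match m with | .inl _ => 2 | .inr _ => 4) else triBound n t v

/-- A (V-oriented) Wilson diagram with `n` external and `t` internal vertices and
slot-counts `bd`.  `anch` sends each end `(e, b)` of a non-Wilson edge `e` to the
vertex it is attached to, together with its position in the V-orientation order
of the non-Wilson edge-ends at that vertex. -/
structure BDiag (n t : ℕ) (bd : Fin n ⊕ Fin t → ℕ) where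
  E : Type
  [fE : Fintype E]
  [dE : DecidableEq E]
  anch : E × Bool ≃ ((v : Fin n ⊕ Fin t) × Fin (bd v))
  npos : 0 < n
  /-- connectivity (through non-Wilson edges together with the Wilson line) -/
  conn : (SimpleGraph.fromRel (fun u v =>
      (∃ (e : E) (b : Bool), (anch (e, b)).1 = u ∧ (anch (e, !b)).1 = v) ∨
      (∃ i j : Fin n, u = Sum.inl i ∧ v = Sum.inl j ∧ (i.val + 1) % n = j.val))).Connected

attribute [instance] BDiag.fE BDiag.dE

/-- the vertex at which the end `(e,b)` is attached. -/
def BDiag.ep {n t : ℕ} {bd : Fin n ⊕ Fin t → ℕ} (Γ : BDiag n t bd) (e : Γ.E) (b : Bool) :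
    Fin n ⊕ Fin t := (Γ.anch (e, b)).1

/-- the V-orientation position of the end `(e,b)` at its vertex. -/
def BDiag.cmp {n t : ℕ} {bd : Fin n ⊕ Fin t → ℕ} (Γ : BDiag n t bd) (e : Γ.E) (b : Bool) :
    ℕ := ((Γ.anch (e, b)).2 : ℕ)

/-- trivalent V-oriented Wilson diagrams. -/
abbrev Tri (n t : ℕ) := BDiag n t (triBound n t)

/-- relabelling of vertices by a rotation `k` of the Wilson line and a
permutation `π` of the internal vertices. -/
def vmap {n t : ℕ} (k : Fin n) (π : Equiv.Perm (Fin t)) :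
    Fin n ⊕ Fin t → Fin n ⊕ Fin t := Sum.map (· + k) π

/-- Isomorphisms of (V-oriented) Wilson diagrams: a bijection `ψ` of edges with
end-flips `fl`, a rotation `k` of the Wilson line (preserving its orientation),
a permutation `π` of internal vertices, and for each vertex a permutation `ρ`
of the local V-orientation orders. -/
structure BIso {n t : ℕ} {bd bd' : Fin n ⊕ Fin t → ℕ}
    (Γ : BDiag n t bd) (Γ' : BDiag n t bd') where
  ψ : Γ.E ≃ Γ'.E
  fl : Γ.E → Bool
  k : Fin n
  π : Equiv.Perm (Fin t)
  ρ : (v : Fin n ⊕ Fin t) → Fin (bd v) ≃ Fin (bd' (vmap k π v))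
  hanch : ∀ (e : Γ.E) (b : Bool),
    Γ'.anch (ψ e, xor (fl e) b) =
      ⟨vmap k π (Γ.anch (e, b)).1, ρ (Γ.anch (e, b)).1 (Γ.anch (e, b)).2⟩

/-- the sign comparing the V-orientation of the target with the V-orientation
induced by the isomorphism (product over all vertices of the signatures of the
local reorderings). -/
noncomputable def BIso.sign {n t : ℕ} {bd bd' : Fin n ⊕ Fin t → ℕ}
    {Γ : BDiag n t bd} {Γ' : BDiag n t bd'} (φ : BIso Γ Γ') : ℤˣ :=
  ∏ v : Fin n ⊕ Fin t, Equiv.Perm.sign ((φ.ρ v).trans (finCongr (by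
    simpa using (Fintype.card_congr (φ.ρ v)).symm)))

/-- Automorphisms of the underlying Wilson graph (forgetting V-orientations):
pairs `(ρ, σ)` of a vertex bijection preserving the oriented Wilson line and an
edge bijection intertwining the boundary maps. -/
structure GAuto {n t : ℕ} {bd : Fin n ⊕ Fin t → ℕ} (Γ : BDiag n t bd) where
  ψ : Equiv.Perm Γ.E
  k : Fin n
  π : Equiv.Perm (Fin t)
  hep : ∀ e : Γ.E,
    (Γ.ep (ψ e) false = vmap k π (Γ.ep e false) ∧ Γ.ep (ψ e) true = vmap k π (Γ.ep e true)) ∨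
    (Γ.ep (ψ e) false = vmap k π (Γ.ep e true) ∧ Γ.ep (ψ e) true = vmap k π (Γ.ep e false))

/-- Isomorphisms of the underlying Wilson graphs (not respecting V-orientation). -/
structure UIso {n t : ℕ} {bd bd' : Fin n ⊕ Fin t → ℕ}
    (Γ : BDiag n t bd) (Γ' : BDiag n t bd') where
  ψ : Γ.E ≃ Γ'.E
  fl : Γ.E → Bool
  k : Fin n
  π : Equiv.Perm (Fin t)
  hep : ∀ (e : Γ.E) (b : Bool), Γ'.ep (ψ e) (xor (fl e) b) = vmap k π (Γ.ep e b)

/-- the interior of a Wilson diagram, as a simple graph on its vertices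
(adjacency through non-Wilson edges only). -/
def intG {n t : ℕ} {bd : Fin n ⊕ Fin t → ℕ} (Γ : BDiag n t bd) :
    SimpleGraph (Fin n ⊕ Fin t) :=
  SimpleGraph.fromRel (fun u v => ∃ (e : Γ.E) (b : Bool), Γ.ep e b = u ∧ Γ.ep e (!b) = v)

end
/- ## Feynman rules: configuration-space integrals of trivalent Wilson diagrams.
   The wedge of the pulled-back Gauss forms, evaluated against the orientation
   `Ω(Γ, or_Γ)` determined by the anchor (V-orientation), is expanded by the
   standard alternating-sum formula over all bijections from edge-ends to
   configuration coordinates. -/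

noncomputable section

open scoped BigOperators

abbrev V3 := Fin 3 → ℝ

def dot3 (a b : V3) : ℝ := a 0 * b 0 + a 1 * b 1 + a 2 * b 2

def cross3 (a b : V3) : V3 :=
  ![a 1 * b 2 - a 2 * b 1, a 2 * b 0 - a 0 * b 2, a 0 * b 1 - a 1 * b 0]

/-- the pullback `u^*ω` of the Gauss two-form on `S²` under `u(x) = x/|x|`,
as a bilinear form at the point `x`:  `(1/4π) ⟨x, a × b⟩ / |x|³`. -/
def gauss2 (x a b : V3) : ℝ :=
  dot3 x (cross3 a b) / (4 * Real.pi * (Real.sqrt (dot3 x x)) ^ 3)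

/-- a smooth embedding `S¹ → ℝ³`, modelled as a 1-periodic smooth immersion of
`ℝ` injective on a period. -/
structure Knot where
  map : ℝ → V3
  smooth : ContDiff ℝ (⊤ : ℕ∞) map
  periodic : Function.Periodic map 1
  injOn : Set.InjOn map (Set.Ico 0 1)
  immersed : ∀ s : ℝ, deriv map s ≠ 0

/-- the configuration space `C_{n,t}(φ)` of `n` cyclically ordered points on the
knot and `t` pairwise distinct points of `ℝ³` off the knot (the circle
parameters are lifted to a fundamental domain). -/
def Config (φ : Knot) (n t : ℕ) : Set ((Fin n → ℝ) × (Fin t → V3)) :=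
  {c | StrictMono c.1 ∧ (∀ i j : Fin n, c.1 i < c.1 j + 1) ∧
       (∀ i : Fin n, 0 ≤ c.1 i) ∧ (n ≠ 0 → ∃ i0 : Fin n, c.1 i0 < 1) ∧
       Function.Injective c.2 ∧
       (∀ (i : Fin n) (j : Fin t), φ.map (c.1 i) ≠ c.2 j)}

/-- the position in `ℝ³` of a vertex of the diagram, at a given configuration. -/
def posOf (φ : Knot) {n t : ℕ} (c : (Fin n → ℝ) × (Fin t → V3)) :
    Fin n ⊕ Fin t → V3
  | .inl i => φ.map (c.1 i)
  | .inr j => c.2 j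

/-- the derivative of the position of a vertex in the direction of a tangent
vector `w` of the configuration space. -/
def dposOf (φ : Knot) {n t : ℕ} (c w : (Fin n → ℝ) × (Fin t → V3)) :
    Fin n ⊕ Fin t → V3
  | .inl i => w.1 i • deriv φ.map (c.1 i)
  | .inr j => w.2 j

/-- the standard basis tangent vector of the configuration space attached to the
coordinate `⟨v, c⟩` (the circle parameter of an external vertex, or one of the
three space coordinates of an internal vertex). -/
def bvec {n t : ℕ} : ((v : Fin n ⊕ Fin t) × Fin (triBound n t v)) →
    (Fin n → ℝ) × (Fin t → V3)
  | ⟨.inl i, _⟩ => (Pi.single i 1, 0)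
  | ⟨.inr j, c⟩ => (0, Pi.single j (Pi.single c (1 : ℝ)))

/-- the integrand of `I(Γ)(φ)`: the wedge `⋀_e φ_e^* ω` of the pulled-back Gauss
forms over all non-Wilson edges, evaluated on the standard coordinate frame
ordered by the orientation `Ω(Γ, or_Γ)` (the sum runs over all bijections
between edge-ends and configuration coordinates, with the sign relative to the
anchor of `Γ`). -/
def integrand {n t : ℕ} (Γ : Tri n t) (φ : Knot)
    (c : (Fin n → ℝ) × (Fin t → V3)) : ℝ :=
  ∑ τ : (Γ.E × Bool) ≃ ((v : Fin n ⊕ Fin t) × Fin (triBound n t v)),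
    ((Equiv.Perm.sign (τ.trans Γ.anch.symm) : ℤ) : ℝ) *
      ∏ e : Γ.E,
        gauss2 (posOf φ c (Γ.ep e true) - posOf φ c (Γ.ep e false))
          (dposOf φ c (bvec (τ (e, false))) (Γ.ep e true) -
            dposOf φ c (bvec (τ (e, false))) (Γ.ep e false))
          (dposOf φ c (bvec (τ (e, true))) (Γ.ep e true) -
            dposOf φ c (bvec (τ (e, true))) (Γ.ep e false))

/-- the configuration-space integral `I(Γ)(φ)`. -/
def Itri {n t : ℕ} (Γ : Tri n t) (φ : Knot) : ℝ :=
  ∫ c in Config φ n t, integrand Γ φ c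

end

noncomputable section

open MeasureTheory Module
open scoped ENNReal

/-- The coordinates of the configuration space, external parameters first. -/
abbrev Slot (n t : ℕ) := Fin n ⊕ (Σ _ : Fin t, Fin 3)

/-- The standard basis of the tangent space of the configuration space. -/
def coordBasis (n t : ℕ) : Basis (Slot n t) ℝ ((Fin n → ℝ) × (Fin t → V3)) :=
  (Pi.basisFun ℝ (Fin n)).prod (Pi.basis fun _ : Fin t => Pi.basisFun ℝ (Fin 3))

/-- Vertex slots of a trivalent diagram are the coordinates of the configuration space. -/
def slotEquiv (n t : ℕ) : ((v : Fin n ⊕ Fin t) × Fin (triBound n t v)) ≃ Slot n t where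
  toFun
    | ⟨.inl i, _⟩ => .inl i
    | ⟨.inr j, c⟩ => .inr ⟨j, c⟩
  invFun
    | .inl i => ⟨.inl i, (0 : Fin 1)⟩
    | .inr ⟨j, c⟩ => ⟨.inr j, c⟩
  left_inv := by
    rintro ⟨i | j, c⟩
    · have : c = (0 : Fin 1) := Subsingleton.elim (α := Fin 1) _ _
      subst this; rfl
    · rfl
  right_inv := by rintro (i | ⟨j, c⟩) <;> rfl

theorem coordBasis_slotEquiv {n t : ℕ} (p : (v : Fin n ⊕ Fin t) × Fin (triBound n t v)) :
    coordBasis n t (slotEquiv n t p) = bvec p := by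
  rcases p with ⟨i | j, c⟩
  · ext <;> simp [coordBasis, slotEquiv, bvec]
  · refine Prod.ext ?_ ?_
    · simp [coordBasis, slotEquiv, bvec]
    · simp only [coordBasis, slotEquiv, bvec, Equiv.coe_fn_mk, Basis.prod_apply_inr_snd,
        Pi.basis_apply]
      exact congrArg _ (Pi.basisFun_apply ℝ (Fin 3) c)

theorem coordBasis_repr_inl {n t : ℕ} (w : (Fin n → ℝ) × (Fin t → V3)) (i : Fin n) :
    (coordBasis n t).repr w (.inl i) = w.1 i := by
  simp [coordBasis]

theorem coordBasis_repr_inr {n t : ℕ} (w : (Fin n → ℝ) × (Fin t → V3)) (j : Σ _ : Fin t, Fin 3) :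
    (coordBasis n t).repr w (.inr j) = w.2 j.1 j.2 := by
  simp [coordBasis]

/-- The edge-ends of a trivalent diagram, indexed by configuration coordinates. -/
def BDiag.row {n t : ℕ} (Γ : Tri n t) : Γ.E × Bool ≃ Slot n t := Γ.anch.trans (slotEquiv n t)

/-- The difference of a vertex function along an edge. -/
def BDiag.diff {n t : ℕ} (Γ : Tri n t) (g : Fin n ⊕ Fin t → V3) (e : Γ.E) : V3 :=
  g (Γ.ep e true) - g (Γ.ep e false)

/-- The two numerators of the gnomonic chart `y κ ≠ 0`. -/
def chartCoord (κ : Fin 3) (b : Bool) : Fin 3 := if b then κ + 2 else κ + 1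

/-- Gnomonic coordinates on the sphere of directions. -/
def gnom (κ : Fin 3) (b : Bool) (y : V3) : ℝ := y (chartCoord κ b) / y κ

/-- The derivative of `gnom κ b` at `y`. -/
def gnomDeriv (κ : Fin 3) (b : Bool) (y : V3) : V3 →L[ℝ] ℝ :=
  (y κ)⁻¹ • (ContinuousLinearMap.proj (R := ℝ) (φ := fun _ : Fin 3 => ℝ) (chartCoord κ b) -
    gnom κ b y • ContinuousLinearMap.proj (R := ℝ) (φ := fun _ : Fin 3 => ℝ) κ)

theorem gnomDeriv_apply (κ : Fin 3) (b : Bool) (y w : V3) :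
    gnomDeriv κ b y w = (y κ)⁻¹ * (w (chartCoord κ b) - gnom κ b y * w κ) := by
  simp [gnomDeriv]

theorem gnomDeriv_self (κ : Fin 3) (b : Bool) {y : V3} (hy : y κ ≠ 0) :
    gnomDeriv κ b y y = 0 := by
  rw [gnomDeriv_apply, gnom, div_mul_cancel₀ _ hy, sub_self, mul_zero]

theorem hasFDerivAt_gnom (κ : Fin 3) (b : Bool) {y : V3} (hy : y κ ≠ 0) :
    HasFDerivAt (gnom κ b) (gnomDeriv κ b y) y := by
  have h := HasFDerivAt.mul
    (hasFDerivAt_apply (𝕜 := ℝ) (F' := fun _ : Fin 3 => ℝ) (chartCoord κ b) y)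
    ((hasDerivAt_inv hy).comp_hasFDerivAt y
      (hasFDerivAt_apply (𝕜 := ℝ) (F' := fun _ : Fin 3 => ℝ) κ y))
  refine h.congr_fderiv ?_
  ext w
  simp [gnomDeriv, gnom]
  field_simp
  ring

theorem norm_eq_abs_of_chart {κ : Fin 3} {y : V3} (h : ∀ i, |y i| ≤ |y κ|) : ‖y‖ = |y κ| := by
  refine le_antisymm ((pi_norm_le_iff_of_nonneg (abs_nonneg _)).2 h) (norm_le_pi_norm y κ)

theorem abs_gnom_le_one {κ : Fin 3} {y : V3} (h : ∀ i, |y i| ≤ |y κ|) (b : Bool) :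
    |gnom κ b y| ≤ 1 := by
  rw [gnom, abs_div]
  exact div_le_one_of_le₀ (h _) (abs_nonneg _)

theorem abs_gnomDeriv_le {κ : Fin 3} {y : V3} (hy : y κ ≠ 0) (h : ∀ i, |y i| ≤ |y κ|) (b : Bool)
    {w : V3} {c L : ℝ} (hw : ‖w - c • y‖ ≤ L * ‖y‖) : |gnomDeriv κ b y w| ≤ 2 * L := by
  have hpos : 0 < |y κ| := abs_pos.2 hy
  have e : gnomDeriv κ b y w = gnomDeriv κ b y (w - c • y) := by
    rw [map_sub, map_smul, gnomDeriv_self κ b hy]; simp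
  rw [e, gnomDeriv_apply, abs_mul, abs_inv, inv_mul_le_iff₀ hpos]
  rw [norm_eq_abs_of_chart h] at hw
  set u := w - c • y
  have h1 : |u (chartCoord κ b)| ≤ L * |y κ| := (norm_le_pi_norm u _).trans hw
  have h2 : |gnom κ b y * u κ| ≤ L * |y κ| := by
    rw [abs_mul]
    calc |gnom κ b y| * |u κ| ≤ 1 * |u κ| := by gcongr; exact abs_gnom_le_one h b
      _ ≤ _ := by rw [one_mul]; exact (norm_le_pi_norm u _).trans hw
  linarith [abs_sub (u (chartCoord κ b)) (gnom κ b y * u κ)]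

/-- The Gauss form in gnomonic coordinates. -/
theorem gauss2_eq_gnomDeriv {κ : Fin 3} {y : V3} (hy : y κ ≠ 0) (a b : V3) :
    gauss2 y a b = (y κ ^ 3 / (4 * Real.pi * (Real.sqrt (dot3 y y)) ^ 3)) *
      (gnomDeriv κ false y a * gnomDeriv κ true y b -
        gnomDeriv κ true y a * gnomDeriv κ false y b) := by
  have key : dot3 y (cross3 a b) = y κ ^ 3 *
      (gnomDeriv κ false y a * gnomDeriv κ true y b -
        gnomDeriv κ true y a * gnomDeriv κ false y b) := by
    simp only [gnomDeriv_apply, gnom, dot3, cross3]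
    fin_cases κ <;> simp [chartCoord] at hy ⊢ <;> field_simp <;> ring
  rw [gauss2, key]; ring

theorem abs_gauss_factor_le_one {κ : Fin 3} (y : V3) :
    |y κ ^ 3 / (4 * Real.pi * (Real.sqrt (dot3 y y)) ^ 3)| ≤ 1 := by
  have h1 : |y κ| ≤ Real.sqrt (dot3 y y) := by
    rw [← Real.sqrt_sq_eq_abs]
    refine Real.sqrt_le_sqrt ?_
    simp only [dot3]
    fin_cases κ <;> simp <;> nlinarith [sq_nonneg (y 0), sq_nonneg (y 1), sq_nonneg (y 2)]
  have h3 : |y κ| ^ 3 ≤ Real.sqrt (dot3 y y) ^ 3 := by gcongr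
  have hp : (1 : ℝ) ≤ 4 * Real.pi := by linarith [Real.pi_gt_three]
  rw [abs_div, abs_pow]
  refine div_le_one_of_le₀ ?_ (abs_nonneg _)
  refine le_trans ?_ (le_abs_self _)
  nlinarith [pow_nonneg (Real.sqrt_nonneg (dot3 y y)) 3]

/-- The velocity of a vertex as a linear function of the tangent vector. -/
def dposL (φ : Knot) {n t : ℕ} (c : (Fin n → ℝ) × (Fin t → V3)) :
    Fin n ⊕ Fin t → (((Fin n → ℝ) × (Fin t → V3)) →L[ℝ] V3)
  | .inl i => ((ContinuousLinearMap.proj i).comp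
      (ContinuousLinearMap.fst ℝ (Fin n → ℝ) (Fin t → V3))).smulRight (deriv φ.map (c.1 i))
  | .inr j => (ContinuousLinearMap.proj j).comp
      (ContinuousLinearMap.snd ℝ (Fin n → ℝ) (Fin t → V3))

theorem dposL_apply (φ : Knot) {n t : ℕ} (c w : (Fin n → ℝ) × (Fin t → V3)) (v : Fin n ⊕ Fin t) :
    dposL φ c v w = dposOf φ c w v := by
  rcases v with i | j <;> simp [dposL, dposOf]

/-- The differential of the gnomonic coordinate of the direction of an edge. -/
def BDiag.rowForm {n t : ℕ} (Γ : Tri n t) (φ : Knot) (κ : Γ.E → Fin 3)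
    (c : (Fin n → ℝ) × (Fin t → V3)) (r : Γ.E × Bool) :
    ((Fin n → ℝ) × (Fin t → V3)) →L[ℝ] ℝ :=
  (gnomDeriv (κ r.1) r.2 (Γ.diff (posOf φ c) r.1)).comp
    (dposL φ c (Γ.ep r.1 true) - dposL φ c (Γ.ep r.1 false))

theorem BDiag.rowForm_apply {n t : ℕ} (Γ : Tri n t) (φ : Knot) (κ : Γ.E → Fin 3)
    (c w : (Fin n → ℝ) × (Fin t → V3)) (r : Γ.E × Bool) :
    Γ.rowForm φ κ c r w =
      gnomDeriv (κ r.1) r.2 (Γ.diff (posOf φ c) r.1) (Γ.diff (dposOf φ c w) r.1) := by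
  simp [BDiag.rowForm, BDiag.diff, dposL_apply]

/-- The values of all edge differentials on a family of tangent vectors. -/
def BDiag.rowMatrix {n t : ℕ} (Γ : Tri n t) (φ : Knot) (κ : Γ.E → Fin 3)
    (c : (Fin n → ℝ) × (Fin t → V3)) (W : Slot n t → (Fin n → ℝ) × (Fin t → V3)) :
    Matrix (Slot n t) (Slot n t) ℝ :=
  Matrix.of fun i j => Γ.rowForm φ κ c (Γ.row.symm i) (W j)

/-- Exchange of the two ends of the edges selected by `T`. -/
def flipEnds {E : Type*} (T : E → Bool) : Equiv.Perm (E × Bool) where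
  toFun r := (r.1, xor (T r.1) r.2)
  invFun r := (r.1, xor (T r.1) r.2)
  left_inv r := by simp
  right_inv r := by simp

/-- Expanding a signed sum of products of `2 × 2` minors into determinants. -/
theorem abs_sum_sign_prod_minor_le {E : Type*} [Fintype E] [DecidableEq E]
    (γ : E → ℝ) (hγ : ∀ e, |γ e| ≤ 1) (A : Matrix (E × Bool) (E × Bool) ℝ) :
    |∑ σ : Equiv.Perm (E × Bool), ((Equiv.Perm.sign σ : ℤ) : ℝ) *
        ∏ e, (γ e * (A (e, false) (σ (e, false)) * A (e, true) (σ (e, true)) -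
          A (e, true) (σ (e, false)) * A (e, false) (σ (e, true))))| ≤
      2 ^ Fintype.card E * |A.det| := by
  have hexp : ∀ σ : Equiv.Perm (E × Bool),
      ∏ e, (A (e, false) (σ (e, false)) * A (e, true) (σ (e, true)) -
          A (e, true) (σ (e, false)) * A (e, false) (σ (e, true))) =
        ∑ T : E → Bool, (∏ e, if T e then (-1 : ℝ) else 1) *
          ∏ r, A (flipEnds T r) (σ r) := by
    intro σ
    have h1 : ∀ e, (A (e, false) (σ (e, false)) * A (e, true) (σ (e, true)) -
          A (e, true) (σ (e, false)) * A (e, false) (σ (e, true))) =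
        ∑ b : Bool, (if b then (-1 : ℝ) else 1) *
          (A (e, xor b true) (σ (e, true)) * A (e, xor b false) (σ (e, false))) := by
      intro e; simp; ring
    simp_rw [h1]
    rw [Fintype.prod_sum]
    refine Finset.sum_congr rfl fun T _ => ?_
    rw [Finset.prod_mul_distrib]
    congr 1
    rw [Fintype.prod_prod_type]
    refine Finset.prod_congr rfl fun e _ => ?_
    rw [Fintype.prod_bool]
    rfl
  have hdet : ∀ T : E → Bool, ∑ σ : Equiv.Perm (E × Bool), ((Equiv.Perm.sign σ : ℤ) : ℝ) *
      ∏ r, A (flipEnds T r) (σ r) = (A.submatrix (flipEnds T) id).det := by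
    intro T
    rw [← Matrix.det_transpose, Matrix.det_apply']
    rfl
  have hsum : ∑ σ : Equiv.Perm (E × Bool), ((Equiv.Perm.sign σ : ℤ) : ℝ) *
        ∏ e, (γ e * (A (e, false) (σ (e, false)) * A (e, true) (σ (e, true)) -
          A (e, true) (σ (e, false)) * A (e, false) (σ (e, true)))) =
      (∏ e, γ e) * ∑ T : E → Bool, (∏ e, if T e then (-1 : ℝ) else 1) *
        (A.submatrix (flipEnds T) id).det := by
    simp_rw [← hdet, Finset.prod_mul_distrib, hexp, Finset.mul_sum]
    rw [Finset.sum_comm]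
    refine Finset.sum_congr rfl fun T _ => Finset.sum_congr rfl fun σ _ => ?_
    ring
  rw [hsum, abs_mul, Finset.abs_prod]
  have hg : ∏ e, |γ e| ≤ 1 := Finset.prod_le_one (fun _ _ => abs_nonneg _) fun e _ => hγ e
  have hT : |∑ T : E → Bool, (∏ e, if T e then (-1 : ℝ) else 1) *
        (A.submatrix (flipEnds T) id).det| ≤ 2 ^ Fintype.card E * |A.det| := by
    refine (Finset.abs_sum_le_sum_abs _ _).trans ?_
    have : ∀ T ∈ (Finset.univ : Finset (E → Bool)), |(∏ e, if T e then (-1 : ℝ) else 1) *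
        (A.submatrix (flipEnds T) id).det| ≤ |A.det| := by
      intro T _
      rw [abs_mul, Finset.abs_prod, Matrix.det_permute, abs_mul]
      have h1 : ∏ e, |if T e then (-1 : ℝ) else 1| = 1 :=
        Finset.prod_eq_one fun e _ => by split_ifs <;> simp
      have h2 : |(((Equiv.Perm.sign (flipEnds T) : ℤ)) : ℝ)| = 1 := by
        rcases Int.units_eq_one_or (Equiv.Perm.sign (flipEnds T)) with h | h <;> simp [h]
      rw [h1, h2]; simp
    refine (Finset.sum_le_card_nsmul _ _ _ this).trans ?_
    simp
  calc (∏ e, |γ e|) * _ ≤ 1 * _ := by gcongr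
    _ ≤ _ := by rw [one_mul]; exact hT

theorem abs_integrand_le {n t : ℕ} (Γ : Tri n t) (φ : Knot) (κ : Γ.E → Fin 3)
    (c : (Fin n → ℝ) × (Fin t → V3)) (hκ : ∀ e, Γ.diff (posOf φ c) e (κ e) ≠ 0) :
    |integrand Γ φ c| ≤
      2 ^ Fintype.card Γ.E * |(Γ.rowMatrix φ κ c (coordBasis n t)).det| := by
  set A : Matrix (Γ.E × Bool) (Γ.E × Bool) ℝ :=
    (Γ.rowMatrix φ κ c (coordBasis n t)).submatrix Γ.row Γ.row with hA
  have hAdet : A.det = (Γ.rowMatrix φ κ c (coordBasis n t)).det :=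
    Matrix.det_submatrix_equiv_self _ _
  rw [← hAdet]
  convert abs_sum_sign_prod_minor_le
    (fun e => Γ.diff (posOf φ c) e (κ e) ^ 3 /
      (4 * Real.pi * (Real.sqrt (dot3 (Γ.diff (posOf φ c) e) (Γ.diff (posOf φ c) e))) ^ 3))
    (fun e => abs_gauss_factor_le_one _) A using 2
  rw [integrand]
  refine Fintype.sum_equiv ((Equiv.refl _).equivCongr Γ.anch.symm) _ _ fun τ => ?_
  congr 1
  refine Finset.prod_congr rfl fun e _ => ?_
  have hent : ∀ b b', A (e, b) (((Equiv.refl _).equivCongr Γ.anch.symm τ) (e, b')) =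
      gnomDeriv (κ e) b (Γ.diff (posOf φ c) e) (Γ.diff (dposOf φ c (bvec (τ (e, b')))) e) := by
    intro b b'
    simp only [hA, Matrix.submatrix_apply, BDiag.rowMatrix, Matrix.of_apply,
      BDiag.rowForm_apply, BDiag.row, Equiv.trans_apply, coordBasis_slotEquiv]
    simp
  rw [hent, hent, hent, hent, ← gauss2_eq_gnomDeriv (hκ e)]
  rfl

/-- Replace the left columns of a matrix by the standard basis vectors selected by `ρ`. -/
def unitLeft {α β : Type*} [DecidableEq α] [DecidableEq β]
    (M : Matrix (α ⊕ β) (α ⊕ β) ℝ) (ρ : α → α ⊕ β) : Matrix (α ⊕ β) (α ⊕ β) ℝ :=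
  Matrix.of fun i j => Sum.elim (fun k => if i = ρ k then 1 else 0) (fun j => M i (.inr j)) j

theorem abs_det_le_prod_mul_sum_unitLeft {α β : Type*} [Fintype α] [Fintype β] [DecidableEq α]
    [DecidableEq β] (M : Matrix (α ⊕ β) (α ⊕ β) ℝ) (L : α → ℝ)
    (hL : ∀ i k, |M i (.inl k)| ≤ L k) :
    |M.det| ≤ (∏ k, L k) * ∑ r : (α ⊕ β) → (α ⊕ β), |(unitLeft M fun k => r (.inl k)).det| := by
  rcases isEmpty_or_nonempty (α ⊕ β) with hemp | hne
  · have : IsEmpty α := ⟨fun a => hemp.elim (.inl a)⟩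
    simp
  set N : ℝ := ((Fintype.card (α ⊕ β) : ℕ) : ℝ) with hN
  have hN1 : 1 ≤ N := by
    rw [hN]; exact_mod_cast Fintype.card_pos
  have hN0 : N ≠ 0 := by positivity
  let coef : (α ⊕ β) → (α ⊕ β) → ℝ := fun i q => Sum.elim (fun k => M q (.inl k)) (fun _ => N⁻¹) i
  let base : (α ⊕ β) → (α ⊕ β) → (α ⊕ β) → ℝ := fun i q =>
    Sum.elim (fun _ => Pi.single q 1) (fun j p => M p (.inr j)) i
  have hM : M.transpose = fun i => ∑ q, coef i q • base i q := by
    funext i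
    rcases i with k | j
    · funext p
      simp [coef, base, Finset.sum_apply, Pi.single_apply]
    · funext p
      simp only [coef, base, Sum.elim_inr, Finset.sum_const, Matrix.transpose_apply]
      simp only [Finset.card_univ, nsmul_eq_mul, Pi.smul_apply, smul_eq_mul]
      change _ = (Fintype.card (α ⊕ β) : ℝ) * (N⁻¹ * M p (.inr j))
      rw [← hN, mul_inv_cancel_left₀ hN0]
  have hdet : M.det = ∑ r : (α ⊕ β) → (α ⊕ β),
      (∏ i, coef i (r i)) * (unitLeft M fun k => r (.inl k)).det := by
    rw [← Matrix.det_transpose, hM]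
    change Matrix.detRowAlternating.toMultilinearMap _ = _
    rw [MultilinearMap.map_sum]
    refine Finset.sum_congr rfl fun r _ => ?_
    rw [MultilinearMap.map_smul_univ, smul_eq_mul]
    congr 1
    rw [← Matrix.det_transpose (unitLeft M _)]
    change Matrix.det _ = _
    congr 1
    ext i p
    rcases i with k | j
    · simp [base, unitLeft, Pi.single_apply]
    · simp [base, unitLeft]
  rw [hdet, Finset.mul_sum]
  refine (Finset.abs_sum_le_sum_abs _ _).trans (Finset.sum_le_sum fun r _ => ?_)
  rw [abs_mul]
  gcongr
  rw [Finset.abs_prod, Fintype.prod_sum_type]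
  have h1 : ∏ k, |coef (.inl k) (r (.inl k))| ≤ ∏ k, L k :=
    Finset.prod_le_prod (fun _ _ => abs_nonneg _) fun k _ => hL _ k
  have h2 : ∏ j, |coef (.inr j) (r (.inr j))| ≤ 1 := by
    refine Finset.prod_le_one (fun _ _ => abs_nonneg _) fun j _ => ?_
    simp only [coef, Sum.elim_inr, abs_inv]
    rw [abs_of_pos (by linarith)]
    exact inv_le_one_of_one_le₀ hN1
  calc _ ≤ (∏ k, L k) * 1 := mul_le_mul h1 h2 (Finset.prod_nonneg fun _ _ => abs_nonneg _)
        ((Finset.prod_nonneg fun _ _ => abs_nonneg _).trans h1)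
    _ = _ := mul_one _

theorem BDiag.rowMatrix_eq_mul {n t : ℕ} (Γ : Tri n t) (φ : Knot) (κ : Γ.E → Fin 3)
    (c : (Fin n → ℝ) × (Fin t → V3)) (W : Slot n t → (Fin n → ℝ) × (Fin t → V3)) :
    Γ.rowMatrix φ κ c W = Γ.rowMatrix φ κ c (coordBasis n t) * (coordBasis n t).toMatrix W := by
  ext i j
  simp only [BDiag.rowMatrix, Matrix.mul_apply, Matrix.of_apply, Basis.toMatrix_apply]
  conv_lhs => rw [← (coordBasis n t).sum_repr (W j), map_sum]
  simp only [map_smul, smul_eq_mul, mul_comm]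

/-- The frame obtained by prescribing the first vectors and keeping the internal coordinates. -/
def extFrame {n t : ℕ} (c : Matrix (Fin n) (Fin n) ℝ) (X : Fin n → Fin t → V3) :
    Slot n t → (Fin n → ℝ) × (Fin t → V3)
  | .inl k => (fun i => c i k, X k)
  | .inr j => coordBasis n t (.inr j)

theorem det_toMatrix_extFrame {n t : ℕ} (c : Matrix (Fin n) (Fin n) ℝ) (X : Fin n → Fin t → V3) :
    ((coordBasis n t).toMatrix (extFrame c X)).det = c.det := by
  have : (coordBasis n t).toMatrix (extFrame c X) =
      Matrix.fromBlocks c 0 (Matrix.of fun j k => X k j.1 j.2) 1 := by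
    ext i j
    rcases i with i | i <;> rcases j with j | j
    · simp [Basis.toMatrix_apply, extFrame, coordBasis_repr_inl]
    · simp [Basis.toMatrix_apply, extFrame]
    · simp [Basis.toMatrix_apply, extFrame, coordBasis_repr_inr]
    · simp only [Basis.toMatrix_apply, extFrame, Basis.repr_self, Matrix.fromBlocks_apply₂₂,
        Matrix.one_apply, Finsupp.single_apply, Sum.inr.injEq, eq_comm]
  rw [this, Matrix.det_fromBlocks_zero₁₂, Matrix.det_one, mul_one]

theorem unitLeft_rowMatrix_extFrame {n t : ℕ} (Γ : Tri n t) (φ : Knot) (κ : Γ.E → Fin 3)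
    (p : (Fin n → ℝ) × (Fin t → V3)) (c : Matrix (Fin n) (Fin n) ℝ) (X : Fin n → Fin t → V3)
    (ρ : Fin n → Slot n t) :
    unitLeft (Γ.rowMatrix φ κ p (extFrame c X)) ρ =
      unitLeft (Γ.rowMatrix φ κ p (coordBasis n t)) ρ := by
  ext i j
  rcases j with j | j <;> simp [unitLeft, BDiag.rowMatrix, extFrame]

theorem measurable_posOf (φ : Knot) {n t : ℕ} (v : Fin n ⊕ Fin t) :
    Measurable fun c : (Fin n → ℝ) × (Fin t → V3) => posOf φ c v := by
  rcases v with i | j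
  · exact φ.smooth.continuous.measurable.comp ((measurable_pi_apply i).comp measurable_fst)
  · exact (measurable_pi_apply j).comp measurable_snd

theorem measurable_dposOf (φ : Knot) {n t : ℕ} (w : (Fin n → ℝ) × (Fin t → V3))
    (v : Fin n ⊕ Fin t) :
    Measurable fun c : (Fin n → ℝ) × (Fin t → V3) => dposOf φ c w v := by
  rcases v with i | j
  · exact ((measurable_deriv φ.map).comp
      ((measurable_pi_apply i).comp measurable_fst)).const_smul (w.1 i)
  · exact measurable_const

theorem BDiag.measurable_rowForm {n t : ℕ} (Γ : Tri n t) (φ : Knot) (κ : Γ.E → Fin 3)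
    (r : Γ.E × Bool) (w : (Fin n → ℝ) × (Fin t → V3)) :
    Measurable fun c : (Fin n → ℝ) × (Fin t → V3) => Γ.rowForm φ κ c r w := by
  simp only [BDiag.rowForm_apply, gnomDeriv_apply, gnom, BDiag.diff, Pi.sub_apply]
  have h1 := fun v i => (measurable_pi_apply i).comp (measurable_posOf (n := n) (t := t) φ v)
  have h2 := fun v i => (measurable_pi_apply i).comp (measurable_dposOf (n := n) (t := t) φ w v)
  simp only [Function.comp_def] at h1 h2
  have h3 := fun i => (h1 (Γ.ep r.1 true) i).sub (h1 (Γ.ep r.1 false) i)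
  have h4 := fun i => (h2 (Γ.ep r.1 true) i).sub (h2 (Γ.ep r.1 false) i)
  exact (h3 _).inv.mul ((h4 _).sub (((h3 _).div (h3 _)).mul (h4 _)))

theorem BDiag.measurable_det_unitLeft {n t : ℕ} (Γ : Tri n t) (φ : Knot) (κ : Γ.E → Fin 3)
    (ρ : Fin n → Slot n t) :
    Measurable fun c : (Fin n → ℝ) × (Fin t → V3) =>
      (unitLeft (Γ.rowMatrix φ κ c (coordBasis n t)) ρ).det := by
  simp only [Matrix.det_apply']
  refine Finset.measurable_sum _ fun σ _ => measurable_const.mul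
    (Finset.measurable_prod _ fun i _ => ?_)
  rcases i with k | j
  · exact measurable_const
  · exact Γ.measurable_rowForm φ κ _ _

theorem measurable_gauss2 {α : Type*} [MeasurableSpace α] {x a b : α → V3} (hx : Measurable x)
    (ha : Measurable a) (hb : Measurable b) : Measurable fun p => gauss2 (x p) (a p) (b p) := by
  have hx' := fun i => (measurable_pi_apply i).comp hx
  have ha' := fun i => (measurable_pi_apply i).comp ha
  have hb' := fun i => (measurable_pi_apply i).comp hb
  simp only [Function.comp_def] at hx' ha' hb'
  simp only [gauss2, dot3, cross3]
  simp
  fun_prop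

theorem measurable_integrand {n t : ℕ} (Γ : Tri n t) (φ : Knot) :
    Measurable (integrand Γ φ) := by
  unfold integrand
  refine Finset.measurable_sum _ fun τ _ => measurable_const.mul
    (Finset.measurable_prod _ fun e _ => ?_)
  exact measurable_gauss2 ((measurable_posOf φ _).sub (measurable_posOf φ _))
    ((measurable_dposOf φ _ _).sub (measurable_dposOf φ _ _))
    ((measurable_dposOf φ _ _).sub (measurable_dposOf φ _ _))

/-- Internal configurations for which all edges lie in the gnomonic charts selected by `κ`. -/
def BDiag.chart {n t : ℕ} (Γ : Tri n t) (φ : Knot) (κ : Γ.E → Fin 3) (s : Fin n → ℝ) :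
    Set (Fin t → V3) :=
  {x | ∀ e, Γ.diff (posOf φ (s, x)) e (κ e) ≠ 0 ∧
    ∀ i, |Γ.diff (posOf φ (s, x)) e i| ≤ |Γ.diff (posOf φ (s, x)) e (κ e)|}

theorem BDiag.measurableSet_chart {n t : ℕ} (Γ : Tri n t) (φ : Knot) (κ : Γ.E → Fin 3)
    (s : Fin n → ℝ) : MeasurableSet (Γ.chart φ κ s) := by
  have h1 : ∀ e i, Measurable fun x : Fin t → V3 => Γ.diff (posOf φ (s, x)) e i := fun e i =>
    (measurable_pi_apply i).comp
      (((measurable_posOf φ _).sub (measurable_posOf φ _)).comp measurable_prodMk_left)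
  simp only [BDiag.chart, Set.ofPred_forall, Set.ofPred_and]
  refine MeasurableSet.iInter fun e => MeasurableSet.inter ?_ (MeasurableSet.iInter fun i => ?_)
  · exact (h1 e (κ e) (measurableSet_singleton 0)).compl
  · exact measurableSet_le (continuous_abs.measurable.comp (h1 e i))
      (continuous_abs.measurable.comp (h1 e (κ e)))

/-- The directions of all edges in gnomonic coordinates, with independent parameters added to the
coordinates selected by `ρ`. -/
def BDiag.gnomMap {n t : ℕ} (Γ : Tri n t) (φ : Knot) (κ : Γ.E → Fin 3) (ρ : Fin n → Slot n t)
    (s : Fin n → ℝ) (p : (Fin n → ℝ) × (Fin t → V3)) : (Fin n → ℝ) × (Fin t → V3) :=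
  (coordBasis n t).equivFunL.symm fun i => (∑ k, if i = ρ k then p.1 k else 0) +
    gnom (κ (Γ.row.symm i).1) (Γ.row.symm i).2 (Γ.diff (posOf φ (s, p.2)) (Γ.row.symm i).1)

/-- The coordinates of the derivative of `gnomMap`. -/
def BDiag.gnomMapDerivCoord {n t : ℕ} (Γ : Tri n t) (φ : Knot) (κ : Γ.E → Fin 3)
    (ρ : Fin n → Slot n t) (s : Fin n → ℝ) (p : (Fin n → ℝ) × (Fin t → V3)) (i : Slot n t) :
    ((Fin n → ℝ) × (Fin t → V3)) →L[ℝ] ℝ :=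
  (∑ k, if i = ρ k then (ContinuousLinearMap.proj (R := ℝ) (φ := fun _ : Fin n => ℝ) k).comp
      (ContinuousLinearMap.fst ℝ (Fin n → ℝ) (Fin t → V3)) else 0) +
    (Γ.rowForm φ κ (s, p.2) (Γ.row.symm i)).comp
      ((ContinuousLinearMap.inr ℝ (Fin n → ℝ) (Fin t → V3)).comp
        (ContinuousLinearMap.snd ℝ (Fin n → ℝ) (Fin t → V3)))

theorem BDiag.gnomMapDerivCoord_apply {n t : ℕ} (Γ : Tri n t) (φ : Knot) (κ : Γ.E → Fin 3)
    (ρ : Fin n → Slot n t) (s : Fin n → ℝ) (p w : (Fin n → ℝ) × (Fin t → V3)) (i : Slot n t) :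
    Γ.gnomMapDerivCoord φ κ ρ s p i w = (∑ k, if i = ρ k then w.1 k else 0) +
      Γ.rowForm φ κ (s, p.2) (Γ.row.symm i) (0, w.2) := by
  simp only [BDiag.gnomMapDerivCoord, add_apply, sum_apply]
  congr 1
  refine Finset.sum_congr rfl fun k _ => ?_
  split_ifs <;> simp

/-- The derivative of `gnomMap`. -/
def BDiag.gnomMapDeriv {n t : ℕ} (Γ : Tri n t) (φ : Knot) (κ : Γ.E → Fin 3)
    (ρ : Fin n → Slot n t) (s : Fin n → ℝ) (p : (Fin n → ℝ) × (Fin t → V3)) :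
    ((Fin n → ℝ) × (Fin t → V3)) →L[ℝ] ((Fin n → ℝ) × (Fin t → V3)) :=
  ((coordBasis n t).equivFunL.symm : (Slot n t → ℝ) →L[ℝ] _).comp
    (ContinuousLinearMap.pi fun i => Γ.gnomMapDerivCoord φ κ ρ s p i)

theorem hasFDerivAt_posOf_snd (φ : Knot) {n t : ℕ} (s : Fin n → ℝ)
    (p : (Fin n → ℝ) × (Fin t → V3)) (v : Fin n ⊕ Fin t) :
    HasFDerivAt (fun p : (Fin n → ℝ) × (Fin t → V3) => posOf φ (s, p.2) v)
      ((dposL φ (s, p.2) v).comp ((ContinuousLinearMap.inr ℝ (Fin n → ℝ) (Fin t → V3)).comp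
        (ContinuousLinearMap.snd ℝ (Fin n → ℝ) (Fin t → V3)))) p := by
  rcases v with i | j
  · refine (hasFDerivAt_const (φ.map (s i)) p).congr_fderiv ?_
    ext w <;> simp [dposL]
  · have h : HasFDerivAt (fun p : (Fin n → ℝ) × (Fin t → V3) => p.2 j)
        ((ContinuousLinearMap.proj j).comp (ContinuousLinearMap.snd ℝ (Fin n → ℝ) (Fin t → V3)))
        p := ContinuousLinearMap.hasFDerivAt
          ((ContinuousLinearMap.proj (R := ℝ) (φ := fun _ : Fin t => V3) j).comp
            (ContinuousLinearMap.snd ℝ (Fin n → ℝ) (Fin t → V3)))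
    refine h.congr_fderiv ?_
    ext w <;> simp [dposL]

theorem BDiag.hasFDerivAt_gnomMap {n t : ℕ} (Γ : Tri n t) (φ : Knot) (κ : Γ.E → Fin 3)
    (ρ : Fin n → Slot n t) (s : Fin n → ℝ) (p : (Fin n → ℝ) × (Fin t → V3))
    (hp : p.2 ∈ Γ.chart φ κ s) :
    HasFDerivAt (Γ.gnomMap φ κ ρ s) (Γ.gnomMapDeriv φ κ ρ s p) p := by
  refine HasFDerivAt.comp p ((coordBasis n t).equivFunL.symm.hasFDerivAt) ?_
  refine hasFDerivAt_pi.2 fun i => HasFDerivAt.add ?_ ?_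
  · refine HasFDerivAt.fun_sum fun k _ => ?_
    split_ifs
    · exact ContinuousLinearMap.hasFDerivAt
        ((ContinuousLinearMap.proj (R := ℝ) (φ := fun _ : Fin n => ℝ) k).comp
          (ContinuousLinearMap.fst ℝ (Fin n → ℝ) (Fin t → V3)))
    · exact hasFDerivAt_const _ _
  · have h := (hasFDerivAt_gnom (κ (Γ.row.symm i).1) (Γ.row.symm i).2
      (hp (Γ.row.symm i).1).1).comp p
      ((hasFDerivAt_posOf_snd φ s p (Γ.ep (Γ.row.symm i).1 true)).sub
        (hasFDerivAt_posOf_snd φ s p (Γ.ep (Γ.row.symm i).1 false)))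
    exact h

theorem BDiag.det_gnomMapDeriv {n t : ℕ} (Γ : Tri n t) (φ : Knot) (κ : Γ.E → Fin 3)
    (ρ : Fin n → Slot n t) (s : Fin n → ℝ) (p : (Fin n → ℝ) × (Fin t → V3)) :
    (Γ.gnomMapDeriv φ κ ρ s p).det =
      (unitLeft (Γ.rowMatrix φ κ (s, p.2) (coordBasis n t)) ρ).det := by
  rw [ContinuousLinearMap.det, ← LinearMap.det_toMatrix (coordBasis n t)]
  congr 1
  ext i j
  have h : LinearMap.toMatrix (coordBasis n t) (coordBasis n t)
      (Γ.gnomMapDeriv φ κ ρ s p : _ →ₗ[ℝ] _) i j =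
      Γ.gnomMapDerivCoord φ κ ρ s p i (coordBasis n t j) := by
    rw [LinearMap.toMatrix_apply, ← Basis.equivFun_apply]
    exact congrFun ((coordBasis n t).equivFun.apply_symm_apply _) i
  rw [h, Γ.gnomMapDerivCoord_apply]
  rcases j with k | j
  · have h1 : (coordBasis n t (.inl k)).1 = Pi.single k 1 := by ext; simp [coordBasis]
    have h2 : (coordBasis n t (.inl k)).2 = 0 := by simp [coordBasis]
    have h3 : ((0 : Fin n → ℝ), (0 : Fin t → V3)) = 0 := rfl
    rw [h1, h2, h3, map_zero, add_zero]
    simp only [Pi.single_apply, unitLeft, Matrix.of_apply, Sum.elim_inl]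
    rw [Finset.sum_eq_single k] <;> simp +contextual
  · have h1 : (coordBasis n t (.inr j)).1 = 0 := by simp [coordBasis]
    have h2 : ((0 : Fin n → ℝ), (coordBasis n t (.inr j)).2) = coordBasis n t (.inr j) :=
      Prod.ext h1.symm rfl
    rw [h1, h2]
    simp [unitLeft, BDiag.rowMatrix]

theorem gnomDeriv_sub_eq_zero {κ : Fin 3} {b : Bool} {y y' : V3} (hy : y κ ≠ 0) (hy' : y' κ ≠ 0)
    (h : gnom κ b y = gnom κ b y') : gnomDeriv κ b y (y - y') = 0 := by
  have h1 : gnomDeriv κ b y y' = 0 := by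
    rw [gnomDeriv_apply, h, gnom, div_mul_cancel₀ _ hy', sub_self, mul_zero]
  rw [map_sub, gnomDeriv_self κ b hy, h1, sub_self]

theorem unitLeft_injective_of_det_ne_zero {α β : Type*} [Fintype α] [Fintype β] [DecidableEq α]
    [DecidableEq β] {M : Matrix (α ⊕ β) (α ⊕ β) ℝ} {ρ : α → α ⊕ β} (h : (unitLeft M ρ).det ≠ 0) :
    Function.Injective ρ := by
  intro k k' hk
  by_contra hne
  refine h (Matrix.det_zero_of_column_eq (i := .inl k) (j := .inl k') (by simpa using hne) ?_)
  intro i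
  simp [unitLeft, hk]

theorem BDiag.injOn_gnomMap {n t : ℕ} (Γ : Tri n t) (φ : Knot) (κ : Γ.E → Fin 3)
    (ρ : Fin n → Slot n t) (s : Fin n → ℝ) :
    Set.InjOn (Γ.gnomMap φ κ ρ s) {p | p.2 ∈ Γ.chart φ κ s ∧
      (unitLeft (Γ.rowMatrix φ κ (s, p.2) (coordBasis n t)) ρ).det ≠ 0} := by
  rintro ⟨a, x⟩ ⟨hx, hdet⟩ ⟨a', x'⟩ ⟨hx', -⟩ heq
  have hcoord := fun i => congrFun ((coordBasis n t).equivFunL.symm.injective heq) i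
  simp only at hcoord hx hx' hdet
  have hρ := unitLeft_injective_of_det_ne_zero hdet
  have hzero : ∀ i, (∀ k, i ≠ ρ k) →
      Γ.rowForm φ κ (s, x) (Γ.row.symm i) (0, x - x') = 0 := by
    intro i hi
    have h := hcoord i
    simp only [hi, if_false, Finset.sum_const_zero, zero_add] at h
    have h0 := gnomDeriv_sub_eq_zero (hx _).1 (hx' _).1 h
    rw [BDiag.rowForm_apply]
    convert h0 using 2
    have hv : ∀ v, dposOf φ (s, x) (0, x - x') v = posOf φ (s, x) v - posOf φ (s, x') v := by
      rintro (i | j) <;> simp [dposOf, posOf]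
    simp only [BDiag.diff, hv]
    abel
  let w : (Fin n → ℝ) × (Fin t → V3) :=
    (fun k => - Γ.rowForm φ κ (s, x) (Γ.row.symm (ρ k)) (0, x - x'), x - x')
  have hw : Γ.gnomMapDeriv φ κ ρ s (a, x) w = 0 := by
    have : (fun i => Γ.gnomMapDerivCoord φ κ ρ s (a, x) i w) = 0 := by
      funext i
      rw [Γ.gnomMapDerivCoord_apply]
      by_cases hi : ∃ k, i = ρ k
      · obtain ⟨k, rfl⟩ := hi
        rw [Finset.sum_eq_single k]
        · simp [w]
        · intro k' _ hk'
          rw [if_neg fun h => hk' (hρ h).symm]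
        · simp
      · push Not at hi
        simp only [hi, if_false, Finset.sum_const_zero, zero_add, w]
        exact hzero i hi
    change (coordBasis n t).equivFunL.symm (fun i => Γ.gnomMapDerivCoord φ κ ρ s (a, x) i w) = 0
    rw [this, map_zero]
  have hw0 : w = 0 := by
    have hd : (Γ.gnomMapDeriv φ κ ρ s (a, x)).det ≠ 0 := by rwa [Γ.det_gnomMapDeriv]
    have hinj := (LinearEquiv.ofIsUnitDet (v := coordBasis n t) (v' := coordBasis n t)
      (f := (Γ.gnomMapDeriv φ κ ρ s (a, x)).toLinearMap)
      (by rw [LinearMap.det_toMatrix]; exact isUnit_iff_ne_zero.2 hd)).injective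
    exact hinj (hw.trans (map_zero (Γ.gnomMapDeriv φ κ ρ s (a, x))).symm)
  have hxx : x = x' := sub_eq_zero.1 (congrArg Prod.snd hw0)
  subst hxx
  refine Prod.ext (funext fun k => ?_) rfl
  have h := hcoord (ρ k)
  simpa [hρ.eq_iff] using h

theorem BDiag.gnomMap_mem_closedBall {n t : ℕ} (Γ : Tri n t) (φ : Knot) (κ : Γ.E → Fin 3)
    (ρ : Fin n → Slot n t) (s : Fin n → ℝ) (p : (Fin n → ℝ) × (Fin t → V3))
    (hp : p.2 ∈ Γ.chart φ κ s) (ha : p.1 ∈ Set.Icc (0 : Fin n → ℝ) 1) :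
    Γ.gnomMap φ κ ρ s p ∈ Metric.closedBall (0 : (Fin n → ℝ) × (Fin t → V3)) (n + 1) := by
  have hi : ∀ i, |(coordBasis n t).equivFun (Γ.gnomMap φ κ ρ s p) i| ≤ n + 1 := by
    intro i
    have : (coordBasis n t).equivFun (Γ.gnomMap φ κ ρ s p) i =
        (∑ k, if i = ρ k then p.1 k else 0) + gnom (κ (Γ.row.symm i).1) (Γ.row.symm i).2
          (Γ.diff (posOf φ (s, p.2)) (Γ.row.symm i).1) :=
      congrFun ((coordBasis n t).equivFun.apply_symm_apply _) i
    rw [this]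
    refine (abs_add_le _ _).trans (add_le_add ?_ (abs_gnom_le_one (hp _).2 _))
    refine (Finset.abs_sum_le_sum_abs _ _).trans ?_
    have h1 : ∀ k ∈ (Finset.univ : Finset (Fin n)), |if i = ρ k then p.1 k else 0| ≤ 1 := by
      intro k _
      have h0 := ha.1 k
      have h1 := ha.2 k
      simp only [Pi.zero_apply, Pi.one_apply] at h0 h1
      split_ifs
      · rw [abs_of_nonneg h0]; exact h1
      · simp
    refine (Finset.sum_le_card_nsmul _ _ _ h1).trans ?_
    simp
  have hpos : (0 : ℝ) ≤ n + 1 := by positivity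
  rw [mem_closedBall_zero_iff, Prod.norm_def, max_le_iff]
  refine ⟨(pi_norm_le_iff_of_nonneg hpos).2 fun k => ?_, (pi_norm_le_iff_of_nonneg hpos).2
    fun j => (pi_norm_le_iff_of_nonneg hpos).2 fun l => ?_⟩
  · have := hi (.inl k)
    rwa [Basis.equivFun_apply, coordBasis_repr_inl] at this
  · have := hi (.inr ⟨j, l⟩)
    rwa [Basis.equivFun_apply, coordBasis_repr_inr] at this

theorem BDiag.lintegral_chart_det_unitLeft_le {n t : ℕ} (Γ : Tri n t) (φ : Knot) (κ : Γ.E → Fin 3)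
    (ρ : Fin n → Slot n t) (s : Fin n → ℝ) :
    ∫⁻ x in Γ.chart φ κ s, ENNReal.ofReal
      |(unitLeft (Γ.rowMatrix φ κ (s, x) (coordBasis n t)) ρ).det| ≤
      volume (Metric.closedBall (0 : (Fin n → ℝ) × (Fin t → V3)) (n + 1)) := by
  set d : (Fin t → V3) → ℝ := fun x =>
    (unitLeft (Γ.rowMatrix φ κ (s, x) (coordBasis n t)) ρ).det with hd
  have hdm : Measurable d := (Γ.measurable_det_unitLeft φ κ ρ).comp measurable_prodMk_left
  set S : Set (Fin t → V3) := Γ.chart φ κ s ∩ {x | d x ≠ 0} with hS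
  have hSm : MeasurableSet S :=
    (Γ.measurableSet_chart φ κ s).inter (hdm (measurableSet_singleton 0)).compl
  set U : Set ((Fin n → ℝ) × (Fin t → V3)) := Set.Icc 0 1 ×ˢ S with hU
  have hUm : MeasurableSet U := measurableSet_Icc.prod hSm
  have : (volume : Measure (Fin t → V3)).IsAddHaarMeasure := Measure.pi.isAddHaarMeasure _
  have : (volume : Measure ((Fin n → ℝ) × (Fin t → V3))).IsAddHaarMeasure :=
    Measure.prod.instIsAddHaarMeasure _ _
  have harea := lintegral_abs_det_fderiv_eq_addHaar_image
    (volume : Measure ((Fin n → ℝ) × (Fin t → V3))) hUm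
    (fun p (hp : p ∈ U) => (Γ.hasFDerivAt_gnomMap φ κ ρ s p hp.2.1).hasFDerivWithinAt)
    ((Γ.injOn_gnomMap φ κ ρ s).mono fun p (hp : p ∈ U) => show _ ∧ _ from ⟨hp.2.1, hp.2.2⟩)
  have himage : Γ.gnomMap φ κ ρ s '' U ⊆
      Metric.closedBall (0 : (Fin n → ℝ) × (Fin t → V3)) (n + 1) := by
    rintro _ ⟨p, hp, rfl⟩
    exact Γ.gnomMap_mem_closedBall φ κ ρ s p hp.2.1 hp.1
  have hleft : ∫⁻ x in Γ.chart φ κ s, ENNReal.ofReal |d x| = ∫⁻ x in S, ENNReal.ofReal |d x| := by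
    rw [← lintegral_indicator (Γ.measurableSet_chart φ κ s), ← lintegral_indicator hSm]
    congr 1
    funext x
    by_cases h : d x = 0
    · simp [Set.indicator, h]
    · have : x ∈ S ↔ x ∈ Γ.chart φ κ s := ⟨And.left, fun hx => ⟨hx, h⟩⟩
      by_cases hx : x ∈ Γ.chart φ κ s
      · rw [Set.indicator_of_mem hx, Set.indicator_of_mem (this.2 hx)]
      · rw [Set.indicator_of_notMem hx, Set.indicator_of_notMem fun h => hx (this.1 h)]
  have hfub : ∫⁻ p in U, ENNReal.ofReal |(Γ.gnomMapDeriv φ κ ρ s p).det| =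
      ∫⁻ x in S, ENNReal.ofReal |d x| := by
    simp only [Γ.det_gnomMapDeriv]
    have hvol : volume (Set.Icc (0 : Fin n → ℝ) 1) = 1 := by simp [Real.volume_Icc_pi]
    rw [hU, Measure.volume_eq_prod, ← Measure.prod_restrict, lintegral_prod_symm']
    · simp [hvol, hd]
    · exact (hdm.comp measurable_snd).abs.ennreal_ofReal
  rw [hleft, ← hfub, harea]
  exact measure_mono himage

theorem Knot.periodic_deriv (φ : Knot) : Function.Periodic (deriv φ.map) 1 := by
  intro s
  rw [← deriv_comp_add_const]
  congr 1
  exact funext φ.periodic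

theorem Function.Periodic.apply_fract {E : Type*} {f : ℝ → E} (hf : Function.Periodic f 1) (s : ℝ) :
    f (Int.fract s) = f s := by
  have := hf.sub_zsmul_eq (x := s) ⌊s⌋
  rwa [zsmul_one] at this

theorem Function.Periodic.exists_norm_le {E : Type*} [SeminormedAddCommGroup E] {f : ℝ → E}
    (hf : Function.Periodic f 1) (hc : Continuous f) : ∃ K : ℝ, ∀ s, ‖f s‖ ≤ K := by
  obtain ⟨K, hK⟩ := (isCompact_Icc (a := (0 : ℝ)) (b := 1)).exists_bound_of_continuousOn
    hc.continuousOn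
  refine ⟨K, fun s => ?_⟩
  rw [← hf.apply_fract s]
  exact hK _ ⟨Int.fract_nonneg s, (Int.fract_lt_one s).le⟩

theorem Knot.contDiff_deriv (φ : Knot) : ContDiff ℝ (⊤ : ℕ∞) (deriv φ.map) :=
  (contDiff_infty_iff_deriv.1 φ.smooth).2

theorem Knot.differentiable (φ : Knot) : Differentiable ℝ φ.map :=
  φ.smooth.differentiable (by simp)

theorem Knot.differentiable_deriv (φ : Knot) : Differentiable ℝ (deriv φ.map) :=
  φ.contDiff_deriv.differentiable (by simp)

/-- Uniform bounds for the first and second derivative of a knot. -/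
theorem Knot.exists_upper_bound (φ : Knot) : ∃ K : ℝ, 1 ≤ K ∧ (∀ s, ‖deriv φ.map s‖ ≤ K) ∧
    ∀ s, ‖deriv (deriv φ.map) s‖ ≤ K := by
  obtain ⟨K₁, h₁⟩ := φ.periodic_deriv.exists_norm_le φ.contDiff_deriv.continuous
  have hper : Function.Periodic (deriv (deriv φ.map)) 1 := by
    intro s
    rw [← deriv_comp_add_const]
    congr 1
    exact funext φ.periodic_deriv
  obtain ⟨K₂, h₂⟩ := hper.exists_norm_le (contDiff_infty_iff_deriv.1 φ.contDiff_deriv).2.continuous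
  exact ⟨max 1 (max K₁ K₂), le_max_left _ _,
    fun s => (h₁ s).trans ((le_max_left _ _).trans (le_max_right _ _)),
    fun s => (h₂ s).trans ((le_max_right _ _).trans (le_max_right _ _))⟩

theorem Knot.norm_sub_le (φ : Knot) {K : ℝ} (hK : ∀ s, ‖deriv φ.map s‖ ≤ K) (s s' : ℝ) :
    ‖φ.map s - φ.map s'‖ ≤ K * |s - s'| :=
  convex_univ.norm_image_sub_le_of_norm_deriv_le (fun x _ => φ.differentiable x)
    (fun x _ => hK x) (Set.mem_univ _) (Set.mem_univ _)

theorem Knot.norm_deriv_sub_le (φ : Knot) {K : ℝ} (hK : ∀ s, ‖deriv (deriv φ.map) s‖ ≤ K)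
    (s s' : ℝ) : ‖deriv φ.map s - deriv φ.map s'‖ ≤ K * |s - s'| :=
  convex_univ.norm_image_sub_le_of_norm_deriv_le (fun x _ => φ.differentiable_deriv x)
    (fun x _ => hK x) (Set.mem_univ _) (Set.mem_univ _)

/-- The failure of a knot to be homogeneous about the parameter `a`. -/
def Knot.defect (φ : Knot) (a s : ℝ) : V3 := (s - a) • deriv φ.map s - (φ.map s - φ.map a)

theorem Knot.defect_self (φ : Knot) (a : ℝ) : φ.defect a a = 0 := by simp [Knot.defect]

theorem Knot.norm_defect_sub_le (φ : Knot) {K : ℝ} (hK : ∀ s, ‖deriv (deriv φ.map) s‖ ≤ K)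
    {a r s s' : ℝ} (hs : |s - a| ≤ r) (hs' : |s' - a| ≤ r) :
    ‖φ.defect a s - φ.defect a s'‖ ≤ K * r * |s - s'| := by
  have hd : ∀ x, HasDerivAt (φ.defect a) ((x - a) • deriv (deriv φ.map) x) x := by
    intro x
    have h1 := ((hasDerivAt_id x).sub_const a).smul (φ.differentiable_deriv x).hasDerivAt
    have h2 := (φ.differentiable x).hasDerivAt.sub_const (φ.map a)
    refine (h1.sub h2).congr_deriv ?_
    simp
  have hmem : ∀ x, x ∈ Metric.closedBall a r ↔ |x - a| ≤ r := fun x => by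
    rw [Metric.mem_closedBall, Real.dist_eq]
  refine (convex_closedBall a r).norm_image_sub_le_of_norm_deriv_le
    (fun x _ => (hd x).differentiableAt) (fun x hx => ?_) ((hmem _).2 hs') ((hmem _).2 hs)
  rw [(hd x).deriv, norm_smul, mul_comm]
  exact mul_le_mul (hK x) ((hmem x).1 hx) (abs_nonneg _) ((norm_nonneg _).trans (hK x))

theorem Knot.map_add_ne (φ : Knot) (s : ℝ) {u : ℝ} (h0 : 0 < u) (h1 : u < 1) :
    φ.map (s + u) ≠ φ.map s := by
  intro h
  rw [← φ.periodic.apply_fract (s + u), ← φ.periodic.apply_fract s] at h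
  have h2 := φ.injOn ⟨Int.fract_nonneg _, Int.fract_lt_one _⟩
    ⟨Int.fract_nonneg _, Int.fract_lt_one _⟩ h
  obtain ⟨z, hz⟩ := Int.fract_eq_fract.1 h2
  rw [add_sub_cancel_left] at hz
  have hz0 : (0 : ℝ) < z := hz ▸ h0
  have hz1 : (z : ℝ) < 1 := hz ▸ h1
  have : (0 : ℤ) < z := by exact_mod_cast hz0
  have : z < (1 : ℤ) := by exact_mod_cast hz1
  omega

theorem Knot.exists_speed_bound (φ : Knot) : ∃ m : ℝ, 0 < m ∧ ∀ s, m ≤ ‖deriv φ.map s‖ := by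
  obtain ⟨x, -, hx⟩ := (isCompact_Icc (a := (0 : ℝ)) (b := 1)).exists_isMinOn
    (Set.nonempty_Icc.2 zero_le_one) φ.contDiff_deriv.continuous.norm.continuousOn
  refine ⟨‖deriv φ.map x‖, norm_pos_iff.2 (φ.immersed x), fun s => ?_⟩
  rw [← φ.periodic_deriv.apply_fract s]
  exact hx ⟨Int.fract_nonneg s, (Int.fract_lt_one s).le⟩

/-- A knot is bi-Lipschitz on arcs of length bounded away from the period. -/
theorem Knot.exists_lower_bound (φ : Knot) {η : ℝ} (hη : η < 1) : ∃ b : ℝ, 0 < b ∧ b ≤ 1 ∧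
    ∀ s s', |s - s'| ≤ η → b * |s - s'| ≤ ‖φ.map s - φ.map s'‖ := by
  obtain ⟨K, hK1, -, hK⟩ := φ.exists_upper_bound
  obtain ⟨m, hm0, hm⟩ := φ.exists_speed_bound
  have hloc : ∀ s s', |s - s'| ≤ m / (2 * K) → m / 2 * |s - s'| ≤ ‖φ.map s - φ.map s'‖ := by
    intro s s' h
    have h1 := φ.norm_defect_sub_le hK (a := s') le_rfl (by simp) (s := s) (s' := s')
    rw [φ.defect_self, sub_zero, Knot.defect] at h1
    have h2 : |s - s'| * m ≤ ‖(s - s') • deriv φ.map s‖ := by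
      rw [norm_smul]; exact mul_le_mul_of_nonneg_left (hm s) (abs_nonneg _)
    have h3 := norm_sub_norm_le ((s - s') • deriv φ.map s) (φ.map s - φ.map s')
    have h4 : K * |s - s'| ≤ m / 2 := by
      rw [le_div_iff₀ (by positivity)] at h; linarith
    have h5 : K * |s - s'| * |s - s'| ≤ m / 2 * |s - s'| :=
      mul_le_mul_of_nonneg_right h4 (abs_nonneg _)
    linarith
  set δ := m / (2 * K)
  have hδ : 0 < δ := by positivity
  obtain ⟨c, hc0, hc⟩ : ∃ c : ℝ, 0 < c ∧ ∀ s u, u ∈ Set.Icc δ η →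
      c ≤ ‖φ.map (s + u) - φ.map s‖ := by
    by_cases hne : (Set.Icc δ η).Nonempty
    · have hcont : Continuous fun p : ℝ × ℝ => ‖φ.map (p.1 + p.2) - φ.map p.1‖ := by
        have := φ.smooth.continuous
        fun_prop
      obtain ⟨p, hp, hmin⟩ := ((isCompact_Icc (a := (0 : ℝ)) (b := 1)).prod
        (isCompact_Icc (a := δ) (b := η))).exists_isMinOn
        ((Set.nonempty_Icc.2 zero_le_one).prod hne) hcont.continuousOn
      refine ⟨_, norm_pos_iff.2 (sub_ne_zero.2 (φ.map_add_ne p.1 (hδ.trans_le hp.2.1)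
        (hp.2.2.trans_lt hη))), fun s u hu => ?_⟩
      have h := hmin (a := (Int.fract s, u)) ⟨⟨Int.fract_nonneg s, (Int.fract_lt_one s).le⟩, hu⟩
      have e : φ.map (Int.fract s + u) = φ.map (s + u) := by
        have := φ.periodic.sub_zsmul_eq (x := s + u) ⌊s⌋
        rw [← this, zsmul_one, ← Int.self_sub_floor]
        congr 1
        ring
      simpa [e, φ.periodic.apply_fract] using h
    · exact ⟨1, one_pos, fun s u hu => (hne ⟨u, hu⟩).elim⟩
  have hpos : ∀ s s', s' ≤ s → |s - s'| ≤ η →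
      min 1 (min (m / 2) c) * |s - s'| ≤ ‖φ.map s - φ.map s'‖ := by
    intro s s' hle h
    rcases le_or_gt |s - s'| δ with h1 | h1
    · refine le_trans ?_ (hloc s s' h1)
      gcongr
      exact (min_le_right _ _).trans (min_le_left _ _)
    · rw [abs_of_nonneg (sub_nonneg.2 hle)] at *
      have h2 := hc s' (s - s') ⟨h1.le, h⟩
      rw [add_sub_cancel] at h2
      refine le_trans ?_ h2
      calc min 1 (min (m / 2) c) * (s - s') ≤ c * 1 :=
            mul_le_mul ((min_le_right _ _).trans (min_le_right _ _)) (h.trans hη.le)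
              (sub_nonneg.2 hle) hc0.le
        _ = c := mul_one c
  refine ⟨min 1 (min (m / 2) c), by positivity, min_le_left _ _, fun s s' h => ?_⟩
  rcases le_total s' s with hle | hle
  · exact hpos s s' hle h
  · rw [norm_sub_rev, abs_sub_comm]
    rw [abs_sub_comm] at h
    exact hpos s' s hle h

/-- The distance from `s k` to the nearest smaller parameter, truncated at `1`. -/
def gap {n : ℕ} (s : Fin n → ℝ) (k : Fin n) : ℝ :=
  Finset.univ.inf' (Finset.univ_nonempty_iff.2 ⟨k⟩) fun j =>
    if s j < s k then min 1 (s k - s j) else 1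

theorem gap_pos {n : ℕ} (s : Fin n → ℝ) (k : Fin n) : 0 < gap s k := by
  rw [gap, Finset.lt_inf'_iff]
  intro j _
  split_ifs with h
  · exact lt_min one_pos (sub_pos.2 h)
  · exact one_pos

theorem gap_le_one {n : ℕ} (s : Fin n → ℝ) (k : Fin n) : gap s k ≤ 1 :=
  (Finset.inf'_le _ (Finset.mem_univ k)).trans (by simp)

theorem gap_le_sub {n : ℕ} (s : Fin n → ℝ) {j k : Fin n} (h : s j < s k) :
    gap s k ≤ s k - s j :=
  (Finset.inf'_le _ (Finset.mem_univ j)).trans (by rw [if_pos h]; exact min_le_right _ _)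

theorem le_gap {n : ℕ} (s : Fin n → ℝ) {k : Fin n} {a : ℝ} (h1 : a ≤ 1)
    (h : ∀ j, s j < s k → a ≤ s k - s j) : a ≤ gap s k := by
  rw [gap, Finset.le_inf'_iff]
  intro j _
  split_ifs with hj
  · exact le_min h1 (h j hj)
  · exact h1

theorem exists_gap_eq_sub {n : ℕ} (s : Fin n → ℝ) {k : Fin n} (h : gap s k < 1) :
    ∃ j, s j < s k ∧ gap s k = s k - s j := by
  obtain ⟨j, -, hj⟩ := Finset.exists_mem_eq_inf' (Finset.univ_nonempty_iff.2 ⟨k⟩)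
    fun j => if s j < s k then min 1 (s k - s j) else 1
  rw [gap, hj] at h
  by_cases hlt : s j < s k
  · refine ⟨j, hlt, ?_⟩
    rw [if_pos hlt] at h hj
    rw [gap, hj]
    rcases min_lt_iff.1 h with h | h
    · exact (lt_irrefl _ h).elim
    · exact min_eq_right h.le
  · rw [if_neg hlt] at h
    exact (lt_irrefl _ h).elim

/-- Lipschitz extension of a finite family of values. -/
theorem exists_lipschitz_extension {ι : Type*} (p w : ι → V3) {L : ℝ} (hL : 0 ≤ L)
    (h : ∀ i j, ‖w i - w j‖ ≤ L * ‖p i - p j‖) :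
    ∃ g : V3 → V3, (∀ x y, ‖g x - g y‖ ≤ L * ‖x - y‖) ∧ ∀ i, g (p i) = w i := by
  have hfac : w.FactorsThrough p := by
    intro i j hij
    have := h i j
    rw [hij, sub_self, norm_zero, mul_zero] at this
    exact sub_eq_zero.1 (norm_le_zero_iff.1 this)
  have happ : ∀ i, Function.extend p w 0 (p i) = w i := hfac.extend_apply 0
  have hlip : LipschitzOnWith ⟨L, hL⟩ (Function.extend p w 0) (Set.range p) := by
    refine LipschitzOnWith.of_dist_le_mul ?_
    rintro _ ⟨i, rfl⟩ _ ⟨j, rfl⟩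
    rw [happ, happ, dist_eq_norm, dist_eq_norm]
    exact h i j
  obtain ⟨g, hg, hgw⟩ := hlip.extend_pi
  refine ⟨g, fun x y => ?_, fun i => ?_⟩
  · have := hg.dist_le_mul x y
    rwa [dist_eq_norm, dist_eq_norm] at this
  · rw [← hgw ⟨i, rfl⟩, happ]

/-- A vertex field whose differences are controlled by the differences of the positions, up to
an infinitesimal dilation. -/
def DilationLipschitz {ι : Type*} (P W : ι → V3) (L : ℝ) : Prop :=
  ∀ u v, ∃ a : ℝ, ‖W u - W v - a • (P u - P v)‖ ≤ L * ‖P u - P v‖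

theorem DilationLipschitz.mono {ι : Type*} {P W : ι → V3} {L L' : ℝ}
    (h : DilationLipschitz P W L) (hL : L ≤ L') : DilationLipschitz P W L' := by
  intro u v
  obtain ⟨a, ha⟩ := h u v
  exact ⟨a, ha.trans (mul_le_mul_of_nonneg_right hL (norm_nonneg _))⟩

theorem DilationLipschitz.const_smul {ι : Type*} {P W : ι → V3} {L : ℝ}
    (h : DilationLipschitz P W L) (c : ℝ) : DilationLipschitz P (fun u => c • W u) (|c| * L) := by
  intro u v
  obtain ⟨a, ha⟩ := h u v
  refine ⟨c * a, ?_⟩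
  rw [← smul_sub, mul_smul, ← smul_sub, norm_smul, mul_assoc]
  exact mul_le_mul_of_nonneg_left ha (abs_nonneg _)

/-- The field moving all external vertices from the `k`-th one on along the knot. -/
theorem exists_tail_field (φ : Knot) {n t : ℕ} {K b : ℝ} (hK0 : 1 ≤ K)
    (hK1 : ∀ s, ‖deriv φ.map s‖ ≤ K) (hK2 : ∀ s, ‖deriv (deriv φ.map) s‖ ≤ K) (hb : 0 < b)
    (s : Fin n → ℝ) (x : Fin t → V3)
    (hs : ∀ i j, b * |s i - s j| ≤ ‖φ.map (s i) - φ.map (s j)‖) (k : Fin n) :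
    ∃ X : Fin t → V3, DilationLipschitz (posOf φ (s, x))
      (dposOf φ (s, x) (fun i => if s k ≤ s i then 1 else 0, X)) (K / b * (gap s k)⁻¹) := by
  have hg := gap_pos s k
  have hL : 0 ≤ K / b * (gap s k)⁻¹ := by positivity
  have hkey : ∀ i j (a : ℝ), a ≤ K * |s i - s j| * (gap s k)⁻¹ →
      a ≤ K / b * (gap s k)⁻¹ * ‖φ.map (s i) - φ.map (s j)‖ := by
    intro i j a ha
    refine ha.trans ?_
    have : |s i - s j| ≤ ‖φ.map (s i) - φ.map (s j)‖ / b := by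
      rw [le_div_iff₀ hb, mul_comm]; exact hs i j
    calc K * |s i - s j| * (gap s k)⁻¹ ≤ K * (‖φ.map (s i) - φ.map (s j)‖ / b) * (gap s k)⁻¹ := by
          gcongr
      _ = _ := by ring
  have hmix : ∀ i j, s k ≤ s i → s j < s k → K ≤ K * |s i - s j| * (gap s k)⁻¹ := by
    intro i j hi hj
    have h1 : gap s k ≤ |s i - s j| :=
      (gap_le_sub s hj).trans ((sub_le_sub_right hi _).trans (le_abs_self _))
    rw [mul_assoc]
    refine le_mul_of_one_le_right (by linarith) ?_
    rwa [← div_eq_mul_inv, one_le_div hg]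
  obtain ⟨g, hg1, hg2⟩ := exists_lipschitz_extension (fun i => φ.map (s i))
    (fun i => (if s k ≤ s i then (1 : ℝ) else 0) • deriv φ.map (s i)) hL (by
      intro i j
      refine hkey i j _ ?_
      by_cases hi : s k ≤ s i <;> by_cases hj : s k ≤ s j
      · simp only [hi, hj, if_true, one_smul]
        refine (φ.norm_deriv_sub_le hK2 _ _).trans (le_mul_of_one_le_right (by positivity) ?_)
        exact (one_le_inv₀ hg).2 (gap_le_one s k)
      · simp only [hi, hj, if_true, if_false, one_smul, zero_smul, sub_zero]
        exact (hK1 _).trans (hmix i j hi (not_le.1 hj))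
      · simp only [hi, hj, if_true, if_false, one_smul, zero_smul, zero_sub, norm_neg]
        rw [abs_sub_comm]
        exact (hK1 _).trans (hmix j i hj (not_le.1 hi))
      · simp only [hi, hj, if_false, zero_smul, sub_self, norm_zero]
        positivity)
  refine ⟨fun v => g (x v), fun u v => ⟨0, ?_⟩⟩
  have hW : ∀ u, dposOf φ (s, x) (fun i => if s k ≤ s i then 1 else 0, fun v => g (x v)) u =
      g (posOf φ (s, x) u) := by
    rintro (i | v)
    · exact (hg2 i).symm
    · rfl
  rw [hW, hW, zero_smul, sub_zero]
  exact hg1 _ _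

/-- The field dilating a cluster of vertices about its first external vertex. -/
theorem exists_cluster_field (φ : Knot) {n t : ℕ} {K b : ℝ} (hK0 : 1 ≤ K)
    (hK1 : ∀ s, ‖deriv φ.map s‖ ≤ K) (hK2 : ∀ s, ‖deriv (deriv φ.map) s‖ ≤ K) (hb : 0 < b)
    (hb1 : b ≤ 1) (s : Fin n → ℝ) (x : Fin t → V3)
    (hs : ∀ i j, b * |s i - s j| ≤ ‖φ.map (s i) - φ.map (s j)‖) (lo : Fin n) {r Q : ℝ}
    (hr : 0 < r) (hQ : 4 * K / b ≤ Q) (hrQ : r * Q ≤ 1)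
    (hi : ∀ i, |s i - s lo| ≤ r ∨ r * Q ≤ |s i - s lo|)
    (hv : ∀ v, ‖x v - φ.map (s lo)‖ ≤ r ∨ r * Q ≤ ‖x v - φ.map (s lo)‖) :
    ∃ X : Fin t → V3, DilationLipschitz (posOf φ (s, x))
      (dposOf φ (s, x) (fun i => if |s i - s lo| ≤ r then s i - s lo else 0, X))
      ((K / b + 2 * (K + K / b * K) / b) * Q⁻¹) := by
  have hKb : 4 ≤ 4 * K / b := by rw [le_div_iff₀ hb]; nlinarith
  have hQ0 : 0 < Q := by linarith
  have hr1 : r ≤ 1 := by nlinarith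
  have hrQ' : r ≤ Q⁻¹ := by rwa [← one_div, le_div_iff₀ hQ0]
  have hKr : K * r ≤ b * (r * Q) / 4 := by
    rw [div_le_iff₀ hb] at hQ
    nlinarith
  set p := φ.map (s lo) with hp
  obtain ⟨g, hg1, hg2⟩ := exists_lipschitz_extension
    (fun i : {i // |s i - s lo| ≤ r} => φ.map (s i)) (fun i => φ.defect (s lo) (s i))
    (L := K / b * r) (by positivity) (by
      intro i j
      refine (φ.norm_defect_sub_le hK2 i.2 j.2).trans ?_
      have : |s i - s j| ≤ ‖φ.map (s i) - φ.map (s j)‖ / b := by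
        rw [le_div_iff₀ hb, mul_comm]; exact hs i j
      calc K * r * |s i - s j| ≤ K * r * (‖φ.map (s i) - φ.map (s j)‖ / b) := by gcongr
        _ = _ := by ring)
  have hgp : g p = 0 := by
    have := hg2 ⟨lo, by simpa using hr.le⟩
    simpa [φ.defect_self] using this
  let I : Fin n ⊕ Fin t → Prop := Sum.elim (fun i => |s i - s lo| ≤ r) (fun v => ‖x v - p‖ ≤ r)
  set P := posOf φ (s, x) with hP
  let X : Fin t → V3 := fun v => if ‖x v - p‖ ≤ r then x v - p + g (x v) else 0
  set W := dposOf φ (s, x) (fun i => if |s i - s lo| ≤ r then s i - s lo else 0, X) with hW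
  have hWin : ∀ u, I u → W u = P u - p + g (P u) := by
    rintro (i | v) h
    · change |s i - s lo| ≤ r at h
      change (if |s i - s lo| ≤ r then s i - s lo else 0) • deriv φ.map (s i) =
        φ.map (s i) - p + g (φ.map (s i))
      rw [if_pos h, hg2 ⟨i, h⟩, Knot.defect]
      abel
    · exact if_pos h
  have hWout : ∀ u, ¬ I u → W u = 0 := by
    rintro (i | v) h
    · change (if |s i - s lo| ≤ r then s i - s lo else 0) • deriv φ.map (s i) = 0
      rw [if_neg (show ¬ |s i - s lo| ≤ r from h), zero_smul]
    · exact if_neg h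
  have hPin : ∀ u, I u → ‖P u - p‖ ≤ K * r := by
    rintro (i | v) h
    · exact (φ.norm_sub_le hK1 _ _).trans (mul_le_mul_of_nonneg_left h (by linarith))
    · exact le_trans (show ‖x v - p‖ ≤ r from h) (le_mul_of_one_le_left hr.le hK0)
  have hPout : ∀ u, ¬ I u → b * (r * Q) ≤ ‖P u - p‖ := by
    rintro (i | v) h
    · exact (mul_le_mul_of_nonneg_left ((hi i).resolve_left h) hb.le).trans (hs i lo)
    · exact (mul_le_of_le_one_left (by positivity) hb1).trans ((hv v).resolve_left h)
  have hmix : ∀ u v, I u → ¬ I v →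
      ‖W u‖ ≤ (K / b + 2 * (K + K / b * K) / b) * Q⁻¹ * ‖P u - P v‖ := by
    intro u v hu hv
    have h1 := hPin u hu
    have h2 := hPout v hv
    have h3 : b * (r * Q) / 2 ≤ ‖P u - P v‖ := by
      have h4 := norm_sub_norm_le (P v - p) (P u - p)
      rw [sub_sub_sub_cancel_right, norm_sub_rev (P v) (P u)] at h4
      have : 0 < b * (r * Q) := by positivity
      linarith
    have h4 : ‖g (P u)‖ ≤ K / b * K * r := by
      have h5 := hg1 (P u) p
      rw [hgp, sub_zero] at h5
      refine h5.trans ?_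
      calc K / b * r * ‖P u - p‖ ≤ K / b * 1 * (K * r) := by gcongr
        _ = _ := by ring
    have h5 : ‖W u‖ ≤ (K + K / b * K) * r := by
      rw [hWin u hu]
      refine (norm_add_le _ _).trans ?_
      linarith
    refine h5.trans ?_
    calc (K + K / b * K) * r = (2 * (K + K / b * K) / b) * Q⁻¹ * (b * (r * Q) / 2) := by
          field_simp
      _ ≤ (2 * (K + K / b * K) / b) * Q⁻¹ * ‖P u - P v‖ := by gcongr
      _ ≤ _ := by
          gcongr
          exact le_add_of_nonneg_left (by positivity)
  refine ⟨X, ?_⟩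
  rw [← hW]
  intro u v
  by_cases hu : I u <;> by_cases hv : I v
  · refine ⟨1, ?_⟩
    rw [hWin u hu, hWin v hv]
    have : P u - p + g (P u) - (P v - p + g (P v)) - (1 : ℝ) • (P u - P v) =
        g (P u) - g (P v) := by rw [one_smul]; abel
    rw [this]
    refine (hg1 _ _).trans ?_
    gcongr
    exact le_add_of_nonneg_right (by positivity)
  · refine ⟨0, ?_⟩
    rw [hWout v hv, sub_zero, zero_smul, sub_zero]
    exact hmix u v hu hv
  · refine ⟨0, ?_⟩
    rw [hWout u hu, zero_sub, zero_smul, sub_zero, norm_neg, norm_sub_rev (P u)]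
    exact hmix v u hv hu
  · refine ⟨0, ?_⟩
    rw [hWout u hu, hWout v hv, sub_zero, zero_smul, sub_zero, norm_zero]
    positivity

/-- A window of prescribed ratio avoiding finitely many scales. -/
theorem exists_scale_window {ι : Type*} [Fintype ι] (a : ι → ℝ) {δ Q : ℝ} (hδ : 0 < δ)
    (hQ : 1 ≤ Q) (hδQ : δ * Q ^ (Fintype.card ι + 1) ≤ 1) :
    ∃ r, δ ≤ r ∧ r * Q ≤ 1 ∧ ∀ i, a i ≤ r ∨ r * Q ≤ a i := by
  by_contra! hcon
  have hm : ∀ m : Fin (Fintype.card ι + 1), ∃ i, δ * Q ^ (m : ℕ) < a i ∧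
      a i < δ * Q ^ ((m : ℕ) + 1) := by
    intro m
    have h := hcon (δ * Q ^ (m : ℕ)) (le_mul_of_one_le_right hδ.le (one_le_pow₀ hQ)) ?_
    · simpa [mul_assoc, pow_succ] using h
    · rw [mul_assoc, ← pow_succ]
      refine le_trans ?_ hδQ
      gcongr
      exact Nat.lt_succ_iff.1 m.is_lt
  choose f hf using hm
  have hlt : ∀ m m', m < m' → a (f m) < a (f m') := by
    intro m m' h
    refine (hf m).2.trans_le (le_trans ?_ (hf m').1.le)
    gcongr
    exact h
  have hinj : Function.Injective f := by
    intro m m' h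
    by_contra hne
    rcases lt_or_gt_of_ne hne with h1 | h1
    · exact (hlt _ _ h1).ne (by rw [h])
    · exact (hlt _ _ h1).ne (by rw [h])
  have := Fintype.card_le_of_injective f hinj
  simp at this

theorem det_eq_one_of_triangular {n : ℕ} (s : Fin n → ℝ) (hs : Function.Injective s)
    (c : Matrix (Fin n) (Fin n) ℝ) (h : ∀ i k, s i < s k → c i k = 0) (h1 : ∀ k, c k k = 1) :
    c.det = 1 := by
  rw [← Matrix.det_submatrix_equiv_self (Tuple.sort s) c, Matrix.det_of_isLowerTriangular]
  · simp [h1]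
  · intro i j hij
    refine h _ _ (lt_of_le_of_ne (Tuple.monotone_sort s (OrderDual.toDual_lt_toDual.1 hij).le) ?_)
    intro he
    exact (OrderDual.toDual_lt_toDual.1 hij).ne ((Tuple.sort s).injective (hs he))

/-- The index set of the scales of a configuration. -/
abbrev Scale (n t : ℕ) := (Fin n × Fin n) ⊕ (Fin n × Fin t)

theorem dposOf_const_smul (φ : Knot) {n t : ℕ} (c : (Fin n → ℝ) × (Fin t → V3)) (a : ℝ)
    (w : Fin n → ℝ) (X : Fin t → V3) :
    dposOf φ c (fun i => a * w i, a • X) = fun u => a • dposOf φ c (w, X) u := by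
  funext u
  rcases u with i | v
  · simp [dposOf, mul_smul]
  · simp [dposOf]

/-- The frame consisting of tail fields, one of which is replaced by a cluster dilation. -/
theorem exists_cluster_frame (φ : Knot) {n t : ℕ} {K b : ℝ} (hK0 : 1 ≤ K)
    (hK1 : ∀ s, ‖deriv φ.map s‖ ≤ K) (hK2 : ∀ s, ‖deriv (deriv φ.map) s‖ ≤ K) (hb : 0 < b)
    (hb1 : b ≤ 1) (s : Fin n → ℝ) (hinj : Function.Injective s) (x : Fin t → V3)
    (hs : ∀ i j, b * |s i - s j| ≤ ‖φ.map (s i) - φ.map (s j)‖) (k₀ : Fin n) {Q : ℝ}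
    (hQ : 4 * K / b ≤ Q) (hgQ : gap s k₀ * Q ^ (Fintype.card (Scale n t) + 1) ≤ 1) :
    ∃ (c : Matrix (Fin n) (Fin n) ℝ) (X : Fin n → Fin t → V3) (k' : Fin n), c.det = 1 ∧
      ∀ k, DilationLipschitz (posOf φ (s, x)) (dposOf φ (s, x) (fun i => c i k, X k))
        ((K / b + 2 * (K + K / b * K) / b) * (gap s k)⁻¹ * if k = k' then Q⁻¹ else 1) := by
  have hQ4 : 4 ≤ Q := le_trans (by rw [le_div_iff₀ hb]; nlinarith) hQ
  have hQ0 : 0 < Q := by linarith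
  obtain ⟨r, hδr, hrQ, hwin⟩ := exists_scale_window
    (Sum.elim (fun q => |s q.1 - s q.2|) (fun q => ‖x q.2 - φ.map (s q.1)‖) : Scale n t → ℝ)
    (gap_pos s k₀) (by linarith : (1 : ℝ) ≤ Q) hgQ
  have hwin1 : ∀ i j, |s i - s j| ≤ r ∨ r * Q ≤ |s i - s j| := fun i j => hwin (.inl (i, j))
  have hwin2 : ∀ i v, ‖x v - φ.map (s i)‖ ≤ r ∨ r * Q ≤ ‖x v - φ.map (s i)‖ :=
    fun i v => hwin (.inr (i, v))
  have hr : 0 < r := (gap_pos s k₀).trans_le hδr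
  have htrans : ∀ i j k, |s i - s j| ≤ r → |s j - s k| ≤ r → |s i - s k| ≤ r := by
    intro i j k h1 h2
    refine (hwin1 i k).resolve_right fun h3 => ?_
    have := abs_sub_le (s i) (s j) (s k)
    nlinarith
  have hgap1 : gap s k₀ < 1 := by
    by_contra! hge
    have : Q ≤ Q ^ (Fintype.card (Scale n t) + 1) := le_self_pow₀ (by linarith) (by simp)
    nlinarith
  obtain ⟨j, hj, hgj⟩ := exists_gap_eq_sub s hgap1
  have hjk : |s k₀ - s j| ≤ r := by rw [abs_of_pos (sub_pos.2 hj), ← hgj]; exact hδr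
  obtain ⟨lo, hlo, hlomin⟩ := Finset.exists_min_image (Finset.univ.filter fun i => |s i - s j| ≤ r)
    s ⟨j, by simpa using hr.le⟩
  simp only [Finset.mem_filter, Finset.mem_univ, true_and] at hlo hlomin
  obtain ⟨k', hk', hkmin⟩ := Finset.exists_min_image
    (Finset.univ.filter fun i => |s i - s j| ≤ r ∧ i ≠ lo) s (by
      by_cases h : j = lo
      · refine ⟨k₀, Finset.mem_filter.2 ⟨Finset.mem_univ _, hjk, fun h' => ?_⟩⟩
        exact hj.ne (by rw [h, h'])
      · exact ⟨j, by simpa using ⟨hr.le, h⟩⟩)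
  simp only [Finset.mem_filter, Finset.mem_univ, true_and] at hk' hkmin
  have hlok : s lo < s k' := lt_of_le_of_ne (hlomin k' hk'.1) fun h => hk'.2 (hinj h).symm
  have hloj : |s j - s lo| ≤ r := by rwa [abs_sub_comm]
  set d := s k' - s lo with hd
  have hd0 : 0 < d := sub_pos.2 hlok
  have hkr : |s k' - s lo| ≤ r := htrans _ _ _ hk'.1 hloj
  obtain ⟨X₀, hX₀⟩ := exists_cluster_field φ hK0 hK1 hK2 hb hb1 s x hs lo hr hQ hrQ
    (fun i => hwin1 i lo) (hwin2 lo)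
  choose X hX using exists_tail_field φ hK0 hK1 hK2 hb s x hs
  refine ⟨Matrix.of fun i k => if k = k' then
      d⁻¹ * (if |s i - s lo| ≤ r then s i - s lo else 0) else if s k ≤ s i then 1 else 0,
    fun k => if k = k' then d⁻¹ • X₀ else X k, k', ?_, fun k => ?_⟩
  · refine det_eq_one_of_triangular s hinj _ (fun i k hik => ?_) (fun k => ?_)
    · simp only [Matrix.of_apply]
      by_cases hk : k = k'
      · subst hk
        rw [if_pos rfl]
        by_cases hir : |s i - s lo| ≤ r
        · have hil : i = lo := by
            by_contra hne
            exact hik.not_ge (hkmin i ⟨htrans i lo j hir hlo, hne⟩)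
          simp [hil]
        · rw [if_neg hir, mul_zero]
      · rw [if_neg hk, if_neg hik.not_ge]
    · simp only [Matrix.of_apply]
      by_cases hk : k = k'
      · subst hk
        rw [if_pos rfl, if_pos hkr, ← hd, inv_mul_cancel₀ hd0.ne']
      · rw [if_neg hk, if_pos le_rfl]
  · by_cases hk : k = k'
    · subst hk
      simp only [Matrix.of_apply, if_true]
      rw [dposOf_const_smul]
      refine (hX₀.const_smul d⁻¹).mono ?_
      rw [abs_of_pos (inv_pos.2 hd0)]
      have : d⁻¹ ≤ (gap s k)⁻¹ := inv_anti₀ (gap_pos s k) (gap_le_sub s hlok)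
      calc d⁻¹ * ((K / b + 2 * (K + K / b * K) / b) * Q⁻¹) ≤
          (gap s k)⁻¹ * ((K / b + 2 * (K + K / b * K) / b) * Q⁻¹) := by gcongr
        _ = _ := by ring
    · simp only [Matrix.of_apply, if_neg hk, mul_one]
      refine (hX k).mono ?_
      have := gap_pos s k
      gcongr
      exact le_add_of_nonneg_right (by positivity)

/-- A frame of the configuration space adapted to the smallest gap. -/
theorem exists_adapted_frame (φ : Knot) (n t : ℕ) {η : ℝ} (hη : η < 1) :
    ∃ C : ℝ, 0 ≤ C ∧ ∀ s : Fin n → ℝ, Function.Injective s → (∀ i j, |s i - s j| ≤ η) →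
      ∀ (x : Fin t → V3) (k₀ : Fin n) (Q : ℝ), 1 ≤ Q →
        gap s k₀ * Q ^ (Fintype.card (Scale n t) + 1) ≤ 1 →
        ∃ (c : Matrix (Fin n) (Fin n) ℝ) (X : Fin n → Fin t → V3) (L : Fin n → ℝ), c.det = 1 ∧
          (∀ k, DilationLipschitz (posOf φ (s, x)) (dposOf φ (s, x) (fun i => c i k, X k)) (L k)) ∧
          ∏ k, L k ≤ C * (Q⁻¹ * ∏ k, (gap s k)⁻¹) := by
  obtain ⟨K, hK0, hK1, hK2⟩ := φ.exists_upper_bound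
  obtain ⟨b, hb, hb1, hlow⟩ := φ.exists_lower_bound hη
  set C₀ := K / b + 2 * (K + K / b * K) / b with hC₀
  have hC₀0 : 0 ≤ C₀ := by positivity
  have hKb : 1 ≤ 4 * K / b := by rw [le_div_iff₀ hb]; linarith
  refine ⟨C₀ ^ n * (4 * K / b), by positivity, fun s hinj hsη x k₀ Q hQ1 hgQ => ?_⟩
  have hQ0 : 0 < Q := by linarith
  have hs : ∀ i j, b * |s i - s j| ≤ ‖φ.map (s i) - φ.map (s j)‖ := fun i j => hlow _ _ (hsη i j)
  have hprod : 0 ≤ ∏ k, (gap s k)⁻¹ := Finset.prod_nonneg fun k _ => (inv_pos.2 (gap_pos s k)).le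
  rcases le_or_gt (4 * K / b) Q with hQ | hQ
  · obtain ⟨c, X, k', hc, hX⟩ := exists_cluster_frame φ hK0 hK1 hK2 hb hb1 s hinj x hs k₀ hQ hgQ
    refine ⟨c, X, _, hc, hX, ?_⟩
    rw [Finset.prod_mul_distrib, Finset.prod_mul_distrib, Finset.prod_ite_eq']
    simp only [Finset.prod_const, Finset.card_univ, Fintype.card_fin, Finset.mem_univ, if_true]
    calc C₀ ^ n * (∏ k, (gap s k)⁻¹) * Q⁻¹ = C₀ ^ n * 1 * (Q⁻¹ * ∏ k, (gap s k)⁻¹) := by ring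
      _ ≤ _ := by gcongr
  · choose X hX using exists_tail_field φ hK0 hK1 hK2 hb s x hs
    refine ⟨Matrix.of fun i k => if s k ≤ s i then 1 else 0, X, fun k => C₀ * (gap s k)⁻¹, ?_,
      fun k => (hX k).mono ?_, ?_⟩
    · refine det_eq_one_of_triangular s hinj _ (fun i k hik => ?_) fun k => ?_
      · simp [hik]
      · simp
    · exact mul_le_mul_of_nonneg_right (le_add_of_nonneg_right (by positivity))
        (inv_nonneg.2 (gap_pos s k).le)
    · rw [Finset.prod_mul_distrib]
      simp only [Finset.prod_const, Finset.card_univ, Fintype.card_fin]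
      have h1 : 1 ≤ 4 * K / b * Q⁻¹ := by
        rw [← div_eq_mul_inv, one_le_div hQ0]; exact hQ.le
      calc C₀ ^ n * ∏ k, (gap s k)⁻¹ ≤ C₀ ^ n * (∏ k, (gap s k)⁻¹) * (4 * K / b * Q⁻¹) :=
            le_mul_of_one_le_right (by positivity) h1
        _ = _ := by ring

theorem gauss2_zero (a b : V3) : gauss2 0 a b = 0 := by simp [gauss2, dot3]

theorem integrand_eq_zero {n t : ℕ} (Γ : Tri n t) (φ : Knot) (c : (Fin n → ℝ) × (Fin t → V3))
    {e : Γ.E} (he : Γ.diff (posOf φ c) e = 0) : integrand Γ φ c = 0 := by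
  refine Finset.sum_eq_zero fun τ _ => ?_
  rw [Finset.prod_eq_zero (Finset.mem_univ e), mul_zero]
  rw [show posOf φ c (Γ.ep e true) - posOf φ c (Γ.ep e false) = 0 from he]
  exact gauss2_zero _ _

/-- The integrand is controlled by the Lipschitz constants of any unimodular frame. -/
theorem abs_integrand_le_of_frame {n t : ℕ} (Γ : Tri n t) (φ : Knot) (s : Fin n → ℝ)
    (x : Fin t → V3) (c : Matrix (Fin n) (Fin n) ℝ) (X : Fin n → Fin t → V3) (L : Fin n → ℝ)
    (hc : c.det = 1)
    (hX : ∀ k, DilationLipschitz (posOf φ (s, x)) (dposOf φ (s, x) (fun i => c i k, X k)) (L k))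
    (κ : Γ.E → Fin 3) (hκ : x ∈ Γ.chart φ κ s) :
    |integrand Γ φ (s, x)| ≤ 2 ^ Fintype.card Γ.E * (2 ^ n * ∏ k, L k) *
      ∑ r : Slot n t → Slot n t,
        |(unitLeft (Γ.rowMatrix φ κ (s, x) (coordBasis n t)) fun k => r (.inl k)).det| := by
  refine (abs_integrand_le Γ φ κ (s, x) fun e => (hκ e).1).trans ?_
  rw [mul_assoc]
  gcongr
  have hdet : (Γ.rowMatrix φ κ (s, x) (extFrame c X)).det =
      (Γ.rowMatrix φ κ (s, x) (coordBasis n t)).det := by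
    rw [Γ.rowMatrix_eq_mul, Matrix.det_mul, det_toMatrix_extFrame, hc, mul_one]
  have h := abs_det_le_prod_mul_sum_unitLeft (Γ.rowMatrix φ κ (s, x) (extFrame c X))
    (fun k => 2 * L k) (by
      intro i k
      simp only [BDiag.rowMatrix, Matrix.of_apply, BDiag.rowForm_apply]
      set e := (Γ.row.symm i).1
      obtain ⟨a, ha⟩ := hX k (Γ.ep e true) (Γ.ep e false)
      exact abs_gnomDeriv_le (hκ e).1 (hκ e).2 _ ha)
  simp only [unitLeft_rowMatrix_extFrame, hdet, Finset.prod_mul_distrib, Finset.prod_const,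
    Finset.card_univ, Fintype.card_fin] at h
  exact h

/-- The sum over all charts of the Jacobians appearing in the area formula. -/
def BDiag.jacobianSum {n t : ℕ} (Γ : Tri n t) (φ : Knot) (s : Fin n → ℝ) (x : Fin t → V3) : ℝ :=
  ∑ κ : Γ.E → Fin 3, (Γ.chart φ κ s).indicator (fun x => ∑ r : Slot n t → Slot n t,
    |(unitLeft (Γ.rowMatrix φ κ (s, x) (coordBasis n t)) fun k => r (.inl k)).det|) x

theorem exists_abs_integrand_le {n t : ℕ} (Γ : Tri n t) (φ : Knot) {η : ℝ} (hη : η < 1) :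
    ∃ C β : ℝ, 0 ≤ C ∧ 0 ≤ β ∧ β < 1 ∧ ∀ s : Fin n → ℝ, Function.Injective s →
      (∀ i j, |s i - s j| ≤ η) → ∀ x : Fin t → V3,
        |integrand Γ φ (s, x)| ≤ C * (∏ k, gap s k ^ (-β)) * Γ.jacobianSum φ s x := by
  obtain ⟨C, hC, hframe⟩ := exists_adapted_frame φ n t hη
  have hn : (0 : ℝ) < n := by exact_mod_cast Γ.npos
  have hn1 : (1 : ℝ) ≤ n := by exact_mod_cast Γ.npos
  set N := Fintype.card (Scale n t) + 1 with hN
  have hN1 : (1 : ℝ) ≤ N := by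
    rw [hN]
    push_cast
    linarith [Nat.cast_nonneg (α := ℝ) (Fintype.card (Scale n t))]
  have hN0 : (0 : ℝ) < N := by linarith
  set ε : ℝ := (N : ℝ)⁻¹ with hε
  have hε0 : 0 < ε := inv_pos.2 hN0
  have hε1 : ε ≤ 1 := inv_le_one_of_one_le₀ hN1
  have hεn : ε / n ≤ 1 := (div_le_one hn).2 (hε1.trans hn1)
  refine ⟨2 ^ Fintype.card Γ.E * (2 ^ n * C), 1 - ε / n, by positivity, by linarith,
    by linarith [div_pos hε0 hn], fun s hinj hs x => ?_⟩
  have hjac : 0 ≤ Γ.jacobianSum φ s x := Finset.sum_nonneg fun κ _ =>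
    Set.indicator_nonneg (fun _ _ => Finset.sum_nonneg fun _ _ => abs_nonneg _) _
  have hgp : 0 ≤ ∏ k, gap s k ^ (-(1 - ε / n)) :=
    Finset.prod_nonneg fun k _ => Real.rpow_nonneg (gap_pos s k).le _
  by_cases hzero : ∃ e, Γ.diff (posOf φ (s, x)) e = 0
  · obtain ⟨e, he⟩ := hzero
    rw [integrand_eq_zero Γ φ _ he, abs_zero]
    positivity
  push Not at hzero
  have hex : ∀ e, ∃ κ : Fin 3, ∀ i, |Γ.diff (posOf φ (s, x)) e i| ≤
      |Γ.diff (posOf φ (s, x)) e κ| := fun e => by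
    obtain ⟨κ, -, hκ⟩ := Finset.exists_max_image Finset.univ
      (fun i => |Γ.diff (posOf φ (s, x)) e i|) ⟨0, Finset.mem_univ _⟩
    exact ⟨κ, fun i => hκ i (Finset.mem_univ _)⟩
  choose κ hκ using hex
  have hchart : x ∈ Γ.chart φ κ s := fun e => ⟨fun h => hzero e (by
    have := norm_eq_abs_of_chart (hκ e)
    rw [h, abs_zero] at this
    exact norm_eq_zero.1 this), hκ e⟩
  obtain ⟨k₀, -, hk₀⟩ := Finset.exists_min_image Finset.univ (gap s)
    ⟨(⟨0, Γ.npos⟩ : Fin n), Finset.mem_univ _⟩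
  have hg0 := gap_pos s k₀
  set Q := gap s k₀ ^ (-ε) with hQ
  have hQ1 : 1 ≤ Q := Real.one_le_rpow_of_pos_of_le_one_of_nonpos hg0 (gap_le_one s k₀)
    (by linarith)
  have hQN : gap s k₀ * Q ^ N ≤ 1 := by
    rw [hQ, ← Real.rpow_natCast, ← Real.rpow_mul hg0.le, hε, neg_mul, inv_mul_cancel₀ hN0.ne',
      Real.rpow_neg_one, mul_inv_cancel₀ hg0.ne']
  obtain ⟨c, X, L, hc, hX, hL⟩ := hframe s hinj hs x k₀ Q hQ1 hQN
  have hQinv : Q⁻¹ * ∏ k, (gap s k)⁻¹ ≤ ∏ k, gap s k ^ (-(1 - ε / n)) := by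
    have h1 : Q⁻¹ = ∏ _k : Fin n, gap s k₀ ^ (ε / n) := by
      rw [hQ, Real.rpow_neg hg0.le, inv_inv, Finset.prod_const, Finset.card_univ, Fintype.card_fin,
        ← Real.rpow_natCast, ← Real.rpow_mul hg0.le, div_mul_cancel₀ _ hn.ne']
    rw [h1, ← Finset.prod_mul_distrib]
    refine Finset.prod_le_prod (fun k _ => mul_nonneg (Real.rpow_nonneg hg0.le _)
      (inv_nonneg.2 (gap_pos s k).le)) fun k _ => ?_
    rw [neg_sub, Real.rpow_sub_one (gap_pos s k).ne', div_eq_mul_inv (gap s k ^ (ε / n))]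
    exact mul_le_mul_of_nonneg_right
      (Real.rpow_le_rpow hg0.le (hk₀ k (Finset.mem_univ k)) (by positivity))
      (inv_nonneg.2 (gap_pos s k).le)
  refine (abs_integrand_le_of_frame Γ φ s x c X L hc hX κ hchart).trans ?_
  have hsum : ∑ r : Slot n t → Slot n t,
        |(unitLeft (Γ.rowMatrix φ κ (s, x) (coordBasis n t)) fun k => r (.inl k)).det| ≤
      Γ.jacobianSum φ s x := by
    rw [BDiag.jacobianSum]
    refine le_trans (le_of_eq ?_) (Finset.single_le_sum (fun κ _ =>
      Set.indicator_nonneg (fun _ _ => Finset.sum_nonneg fun _ _ => abs_nonneg _) _)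
      (Finset.mem_univ κ))
    rw [Set.indicator_of_mem hchart]
  have hprod : ∏ k, L k ≤ C * ∏ k, gap s k ^ (-(1 - ε / n)) :=
    hL.trans (mul_le_mul_of_nonneg_left hQinv hC)
  calc _ ≤ 2 ^ Fintype.card Γ.E * (2 ^ n * (C * ∏ k, gap s k ^ (-(1 - ε / n)))) *
        Γ.jacobianSum φ s x := by
        gcongr
    _ = _ := by ring

/-- A finite bound, uniform in the external parameters, for the integral of the Jacobians. -/
theorem exists_lintegral_jacobianSum_le {n t : ℕ} (Γ : Tri n t) (φ : Knot) :
    ∃ V : ℝ≥0∞, V ≠ ∞ ∧ ∀ s : Fin n → ℝ, ∫⁻ x, ENNReal.ofReal (Γ.jacobianSum φ s x) ≤ V := by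
  refine ⟨∑ _κ : Γ.E → Fin 3, ∑ _r : Slot n t → Slot n t,
    volume (Metric.closedBall (0 : (Fin n → ℝ) × (Fin t → V3)) (n + 1)), ?_, fun s => ?_⟩
  · have := (isCompact_closedBall (0 : (Fin n → ℝ) × (Fin t → V3)) (n + 1)).measure_lt_top
      (μ := volume)
    exact ENNReal.sum_ne_top.2 fun _ _ => ENNReal.sum_ne_top.2 fun _ _ => this.ne
  · have hm : ∀ κ (r : Slot n t → Slot n t), Measurable fun x => ENNReal.ofReal
        |(unitLeft (Γ.rowMatrix φ κ (s, x) (coordBasis n t)) fun k => r (.inl k)).det| :=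
      fun κ r => ((Γ.measurable_det_unitLeft φ κ _).comp
        measurable_prodMk_left).abs.ennreal_ofReal
    have heq : ∀ x, ENNReal.ofReal (Γ.jacobianSum φ s x) = ∑ κ : Γ.E → Fin 3,
        (Γ.chart φ κ s).indicator (fun x => ∑ r : Slot n t → Slot n t, ENNReal.ofReal
          |(unitLeft (Γ.rowMatrix φ κ (s, x) (coordBasis n t)) fun k => r (.inl k)).det|) x := by
      intro x
      rw [BDiag.jacobianSum, ENNReal.ofReal_sum_of_nonneg fun κ _ =>
        Set.indicator_nonneg (fun _ _ => Finset.sum_nonneg fun _ _ => abs_nonneg _) _]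
      refine Finset.sum_congr rfl fun κ _ => ?_
      by_cases hx : x ∈ Γ.chart φ κ s
      · rw [Set.indicator_of_mem hx, Set.indicator_of_mem hx,
          ENNReal.ofReal_sum_of_nonneg fun _ _ => abs_nonneg _]
      · rw [Set.indicator_of_notMem hx, Set.indicator_of_notMem hx, ENNReal.ofReal_zero]
    simp only [heq]
    rw [lintegral_finsetSum _ fun κ _ => (Finset.measurable_fun_sum _ fun r _ => hm κ r).indicator
      (Γ.measurableSet_chart φ κ s)]
    refine Finset.sum_le_sum fun κ _ => ?_
    rw [lintegral_indicator (Γ.measurableSet_chart φ κ s), lintegral_finsetSum _ fun r _ => hm κ r]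
    exact Finset.sum_le_sum fun r _ => Γ.lintegral_chart_det_unitLeft_le φ κ _ s

/-- Integration of a chain of kernels, one variable at a time. -/
theorem lintegral_chain_le (μ : Measure ℝ) [SigmaFinite μ] {w : ℝ → ℝ → ℝ≥0∞}
    (hw : Measurable (Function.uncurry w)) {M : ℝ≥0∞} (hM : ∀ u, ∫⁻ a, w u a ∂μ ≤ M) (n : ℕ) :
    ∫⁻ s, ∏ k : Fin n, w (s k.succ) (s k.castSucc) ∂(Measure.pi fun _ : Fin (n + 1) => μ) ≤
      M ^ n * μ Set.univ := by
  induction n with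
  | zero => simp [Measure.pi_univ]
  | succ n ih =>
    rw [← ((measurePreserving_piFinSuccAbove (fun _ : Fin (n + 2) => μ) 0).symm).lintegral_comp_emb
      (MeasurableEquiv.measurableEmbedding _)]
    have hmeas : Measurable fun p : ℝ × (Fin (n + 1) → ℝ) =>
        w (p.2 0) p.1 * ∏ k : Fin n, w (p.2 k.succ) (p.2 k.castSucc) := by
      have h (i : Fin (n + 1)) : Measurable fun p : ℝ × (Fin (n + 1) → ℝ) => p.2 i :=
        (measurable_pi_apply i).comp measurable_snd
      refine (hw.comp ((h 0).prodMk measurable_fst)).mul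
        (Finset.measurable_fun_prod _ fun k _ => ?_)
      exact hw.comp ((h k.succ).prodMk (h k.castSucc))
    calc _ = ∫⁻ p : ℝ × (Fin (n + 1) → ℝ), w (p.2 0) p.1 *
          ∏ k : Fin n, w (p.2 k.succ) (p.2 k.castSucc)
            ∂(μ.prod (Measure.pi fun _ : Fin (n + 1) => μ)) := by
          refine lintegral_congr fun p => ?_
          rw [Fin.prod_univ_succ]
          rfl
      _ = ∫⁻ s, ∫⁻ a, w (s 0) a * ∏ k : Fin n, w (s k.succ) (s k.castSucc) ∂μ
            ∂(Measure.pi fun _ : Fin (n + 1) => μ) := lintegral_prod_symm' _ hmeas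
      _ ≤ ∫⁻ s, M * ∏ k : Fin n, w (s k.succ) (s k.castSucc)
            ∂(Measure.pi fun _ : Fin (n + 1) => μ) := by
          refine lintegral_mono fun s => ?_
          have h : Measurable (w (s 0)) := hw.comp measurable_prodMk_left
          rw [lintegral_mul_const _ h]
          exact mul_le_mul_left (hM _) _
      _ = M * ∫⁻ s, ∏ k : Fin n, w (s k.succ) (s k.castSucc)
            ∂(Measure.pi fun _ : Fin (n + 1) => μ) := by
          refine lintegral_const_mul _ (Finset.measurable_fun_prod _ fun k _ => ?_)
          have h (i : Fin (n + 1)) : Measurable fun s : Fin (n + 1) → ℝ => s i :=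
            measurable_pi_apply i
          exact hw.comp ((h k.succ).prodMk (h k.castSucc))
      _ ≤ M * (M ^ n * μ Set.univ) := mul_le_mul_right ih _
      _ = _ := by ring

/-- The kernel which dominates the power `-β` of the truncated gap. -/
def gapKernel (β v : ℝ) : ℝ≥0∞ :=
  1 + (Set.Icc (-1) 1).indicator (fun v => ENNReal.ofReal (|v| ^ (-β))) v

theorem measurable_gapKernel (β : ℝ) : Measurable (gapKernel β) :=
  measurable_const.add (Measurable.indicator (f := fun v : ℝ => ENNReal.ofReal (|v| ^ (-β)))
    (by fun_prop) measurableSet_Icc)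

theorem lintegral_abs_rpow_lt_top {β : ℝ} (hβ : β < 1) :
    ∫⁻ v in Set.Icc (-1 : ℝ) 1, ENNReal.ofReal (|v| ^ (-β)) < ∞ := by
  have h1 : IntervalIntegrable (fun v : ℝ => |v| ^ (-β)) volume 0 1 :=
    (intervalIntegral.intervalIntegrable_rpow' (r := -β) (a := 0) (b := 1) (by linarith)).congr
      fun v hv => by
        rw [Set.uIoc_of_le zero_le_one] at hv
        simp [abs_of_pos hv.1]
  have h2 : IntervalIntegrable (fun v : ℝ => |v| ^ (-β)) volume (-1) 0 := by
    have := (IntervalIntegrable.iff_comp_neg (by simp)).1 h1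
    simp only [abs_neg, neg_zero] at this
    exact this.symm
  have h := (intervalIntegrable_iff_integrableOn_Icc_of_le (by norm_num)).1 (h2.trans h1)
  exact h.lintegral_lt_top

theorem exists_lintegral_gapKernel_le {β : ℝ} (hβ : β < 1) (R : ℝ) :
    ∃ M : ℝ≥0∞, M ≠ ∞ ∧ ∀ u, ∫⁻ a in Set.Icc 0 R, gapKernel β (u - a) ≤ M := by
  refine ⟨volume (Set.Icc 0 R) + ∫⁻ v in Set.Icc (-1 : ℝ) 1, ENNReal.ofReal (|v| ^ (-β)),
    ENNReal.add_ne_top.2 ⟨measure_Icc_lt_top.ne, (lintegral_abs_rpow_lt_top hβ).ne⟩, fun u => ?_⟩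
  simp only [gapKernel]
  rw [lintegral_add_left measurable_const, lintegral_one, Measure.restrict_apply_univ]
  refine add_le_add_right ?_ _
  refine (setLIntegral_le_lintegral _ _).trans ?_
  rw [lintegral_sub_left_eq_self, lintegral_indicator measurableSet_Icc]

theorem ofReal_gap_rpow_le {n : ℕ} {β : ℝ} (hβ : 0 ≤ β) (s : Fin (n + 1) → ℝ)
    (σ : Equiv.Perm (Fin (n + 1))) (hσ : StrictMono (s ∘ σ)) :
    ∏ k, ENNReal.ofReal (gap s k ^ (-β)) ≤
      ∏ k : Fin n, gapKernel β (s (σ k.succ) - s (σ k.castSucc)) := by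
  have hone : ∀ k, 1 ≤ gap s k → ENNReal.ofReal (gap s k ^ (-β)) = 1 := fun k hk => by
    rw [le_antisymm (gap_le_one s k) hk, Real.one_rpow, ENNReal.ofReal_one]
  have hlt : ∀ {i j}, s (σ i) < s (σ j) → i < j := fun h => hσ.lt_iff_lt.1 h
  rw [← Equiv.prod_comp σ, Fin.prod_univ_succ, hone _ (le_gap s le_rfl fun j hj => ?_), one_mul]
  · refine Finset.prod_le_prod' fun k _ => ?_
    set d := s (σ k.succ) - s (σ k.castSucc) with hd
    have hd0 : 0 < d := sub_pos.2 (hσ k.castSucc_lt_succ)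
    have hle : min 1 d ≤ gap s (σ k.succ) := by
      refine le_gap s (min_le_left _ _) fun j hj => (min_le_right _ _).trans ?_
      obtain ⟨i, rfl⟩ := σ.surjective j
      have : s (σ i) ≤ s (σ k.castSucc) :=
        hσ.monotone (Fin.le_castSucc_iff.2 (hlt hj))
      linarith
    rcases le_or_gt 1 d with h1 | h1
    · rw [hone _ (by rwa [min_eq_left h1] at hle)]
      exact le_self_add
    · rw [min_eq_right h1.le] at hle
      have hmem : d ∈ Set.Icc (-1 : ℝ) 1 := ⟨by linarith, h1.le⟩
      rw [gapKernel, Set.indicator_of_mem hmem, abs_of_pos hd0]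
      refine le_trans (ENNReal.ofReal_le_ofReal ?_) le_add_self
      exact Real.rpow_le_rpow_of_nonpos hd0 hle (by linarith)
  · obtain ⟨i, rfl⟩ := σ.surjective j
    exact absurd (hlt hj) (Fin.not_lt_zero i)

theorem measurableSet_injective (n : ℕ) :
    MeasurableSet {s : Fin n → ℝ | Function.Injective s} := by
  have : {s : Fin n → ℝ | Function.Injective s} = ⋂ i, ⋂ j, {s | s i = s j → i = j} := by
    ext s
    simp [Function.Injective]
  rw [this]
  refine MeasurableSet.iInter fun i => MeasurableSet.iInter fun j => ?_
  by_cases hij : i = j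
  · simp [hij]
  · simp only [hij, imp_false]
    exact (measurableSet_eq_fun (measurable_pi_apply i) (measurable_pi_apply j)).compl

/-- The gap weight is integrable over bounded boxes. -/
theorem lintegral_prod_gap_rpow_lt_top (n : ℕ) {β : ℝ} (hβ : 0 ≤ β) (hβ1 : β < 1) (R : ℝ) :
    ∫⁻ s in {s : Fin n → ℝ | Function.Injective s} ∩ Set.univ.pi fun _ => Set.Icc 0 R,
      ∏ k, ENNReal.ofReal (gap s k ^ (-β)) < ∞ := by
  cases n with
  | zero =>
    simp only [Finset.univ_eq_empty, Finset.prod_empty, lintegral_one,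
      Measure.restrict_apply_univ]
    refine (measure_mono Set.inter_subset_right).trans_lt ?_
    simp [volume_pi]
  | succ n =>
    obtain ⟨M, hM, hM'⟩ := exists_lintegral_gapKernel_le hβ1 R
    set μ : Measure ℝ := volume.restrict (Set.Icc 0 R)
    have hw : Measurable (Function.uncurry fun u a : ℝ => gapKernel β (u - a)) :=
      (measurable_gapKernel β).comp (measurable_fst.sub measurable_snd)
    have hbox : (volume : Measure (Fin (n + 1) → ℝ)).restrict
        (Set.univ.pi fun _ => Set.Icc 0 R) = Measure.pi fun _ => μ :=
      Measure.restrict_pi_pi _ _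
    calc _ ≤ ∫⁻ s in {s : Fin (n + 1) → ℝ | Function.Injective s} ∩
          Set.univ.pi fun _ => Set.Icc 0 R, ∑ σ : Equiv.Perm (Fin (n + 1)),
            ∏ k : Fin n, gapKernel β (s (σ k.succ) - s (σ k.castSucc)) := by
          refine setLIntegral_mono' ((measurableSet_injective _).inter
            (MeasurableSet.univ_pi fun _ => measurableSet_Icc)) fun s hs => ?_
          have hσ : StrictMono (s ∘ Tuple.sort s) := (Tuple.monotone_sort s).strictMono_of_injective
            (hs.1.comp (Tuple.sort s).injective)
          exact (ofReal_gap_rpow_le hβ s _ hσ).trans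
            (Finset.single_le_sum (f := fun σ : Equiv.Perm (Fin (n + 1)) =>
              ∏ k : Fin n, gapKernel β (s (σ k.succ) - s (σ k.castSucc)))
              (fun _ _ => zero_le) (Finset.mem_univ _))
      _ ≤ ∫⁻ s, ∑ σ : Equiv.Perm (Fin (n + 1)),
            ∏ k : Fin n, gapKernel β (s (σ k.succ) - s (σ k.castSucc))
            ∂(Measure.pi fun _ : Fin (n + 1) => μ) := by
          rw [← hbox]
          exact lintegral_mono_set Set.inter_subset_right
      _ = ∑ σ : Equiv.Perm (Fin (n + 1)), ∫⁻ s,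
            ∏ k : Fin n, gapKernel β (s (σ k.succ) - s (σ k.castSucc))
            ∂(Measure.pi fun _ : Fin (n + 1) => μ) := by
          refine lintegral_finsetSum _ fun σ _ => Finset.measurable_fun_prod _ fun k _ => ?_
          exact (measurable_gapKernel β).comp
            ((measurable_pi_apply _).sub (measurable_pi_apply _))
      _ ≤ ∑ _σ : Equiv.Perm (Fin (n + 1)), M ^ n * μ Set.univ := by
          refine Finset.sum_le_sum fun σ _ => ?_
          rw [← (measurePreserving_piCongrLeft (fun _ : Fin (n + 1) => μ) σ).lintegral_comp_emb
            (MeasurableEquiv.measurableEmbedding _)]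
          refine le_trans (le_of_eq ?_) (lintegral_chain_le μ hw hM' n)
          refine lintegral_congr fun s => Finset.prod_congr rfl fun k _ => ?_
          simp [MeasurableEquiv.coe_piCongrLeft, Equiv.piCongrLeft_apply]
      _ < ∞ := by
          rw [ENNReal.sum_lt_top]
          exact fun _ _ => ENNReal.mul_lt_top (ENNReal.pow_lt_top hM.lt_top)
            (by simp [μ])

/-- The translation of the external parameters in `T` by one period. -/
def periodShift {n : ℕ} (T : Finset (Fin n)) (i : Fin n) : ℝ := if i ∈ T then 1 else 0

/-- After translating some of the parameters by one period, the parameters of a configuration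
lie in an arc which omits a definite part of the knot. -/
theorem exists_periodShift {n : ℕ} (s : Fin n → ℝ) (hs : StrictMono s)
    (hlt : ∀ i j, s i < s j + 1) : ∃ T : Finset (Fin n),
      Function.Injective (s + periodShift T) ∧
      ∀ i j, |(s + periodShift T) i - (s + periodShift T) j| ≤ 1 - 1 / (n : ℝ) := by
  by_cases hgap : ∃ k l : Fin n, (k : ℕ) + 1 = l ∧ 1 / (n : ℝ) ≤ s l - s k
  · obtain ⟨k, l, hkl, hd⟩ := hgap
    refine ⟨Finset.Iic k, fun i j hij => ?_, fun i j => ?_⟩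
    · simp only [Pi.add_apply, periodShift, Finset.mem_Iic] at hij
      have h1 := hlt i j
      have h2 := hlt j i
      split_ifs at hij
      · exact hs.injective (by linarith)
      · linarith
      · linarith
      · exact hs.injective (by linarith)
    · have hle : ∀ i, i ≤ k → s i ≤ s k := fun i hi => hs.monotone hi
      have hge : ∀ i, ¬ i ≤ k → s l ≤ s i := fun i hi => hs.monotone (by
        rw [Fin.le_def] at hi ⊢
        omega)
      simp only [Pi.add_apply, periodShift, Finset.mem_Iic]
      have h1 := hlt i j
      have h2 := hlt j i
      have h3 := hlt l i
      have h4 := hlt l j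
      have h5 := hlt i k
      have h6 := hlt j k
      split_ifs with hi hj hj <;> rw [abs_le]
      · have := hle i hi
        have := hle j hj
        constructor <;> linarith
      · have := hle i hi
        have := hge j hj
        have : 0 ≤ 1 / (n : ℝ) := by positivity
        constructor <;> linarith
      · have := hge i hi
        have := hle j hj
        have : 0 ≤ 1 / (n : ℝ) := by positivity
        constructor <;> linarith
      · have := hge i hi
        have := hge j hj
        constructor <;> linarith
  · push Not at hgap
    refine ⟨∅, ?_, fun i j => ?_⟩
    · have : s + periodShift ∅ = s := by
        ext i
        simp [periodShift]
      rw [this]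
      exact hs.injective
    · have hn : 0 < n := i.pos
      have hn' : (0 : ℝ) < n := by exact_mod_cast hn
      have hup : ∀ (m : ℕ) (hm : m < n), s ⟨m, hm⟩ ≤ s ⟨0, hn⟩ + m / n := by
        intro m
        induction m with
        | zero => intro _; simp
        | succ m ih =>
          intro hm
          have h1 := ih (by omega)
          have h2 := hgap ⟨m, by omega⟩ ⟨m + 1, hm⟩ rfl
          push_cast
          rw [add_div]
          linarith
      have hlow : ∀ i, s ⟨0, hn⟩ ≤ s i := fun i => hs.monotone (by simp [Fin.le_def])
      have hupn : ∀ i, s i ≤ s ⟨0, hn⟩ + (1 - 1 / (n : ℝ)) := fun i => by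
        refine (hup i i.2).trans ?_
        have h1 : (i : ℝ) + 1 ≤ n := by exact_mod_cast i.2
        have h2 : (1 : ℝ) - 1 / n = (n - 1) / n := by field_simp
        rw [h2]
        gcongr
        linarith
      simp only [Pi.add_apply, periodShift, Finset.notMem_empty, if_false, add_zero]
      have h1 := hlow i
      have h2 := hlow j
      have h3 := hupn i
      have h4 := hupn j
      rw [abs_le]
      constructor <;> linarith

theorem integrand_add_periodShift {n t : ℕ} (Γ : Tri n t) (φ : Knot) (T : Finset (Fin n))
    (c : (Fin n → ℝ) × (Fin t → V3)) :
    integrand Γ φ (c + (periodShift T, 0)) = integrand Γ φ c := by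
  have hpos : posOf φ (c + (periodShift T, 0)) = posOf φ c := by
    funext v
    rcases v with i | j
    · by_cases hi : i ∈ T
      · simp [posOf, periodShift, hi, φ.periodic (c.1 i)]
      · simp [posOf, periodShift, hi]
    · simp [posOf]
  have hdpos : ∀ w, dposOf φ (c + (periodShift T, 0)) w = dposOf φ c w := by
    intro w
    funext v
    rcases v with i | j
    · by_cases hi : i ∈ T
      · simp [dposOf, periodShift, hi, φ.periodic_deriv (c.1 i)]
      · simp [dposOf, periodShift, hi]
    · simp [dposOf]
  simp only [integrand, hpos, hdpos]

/-- Bounded injective tuples of parameters which are contained in an arc of length `η`. -/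
def arcTuples (n : ℕ) (η : ℝ) : Set (Fin n → ℝ) :=
  {s | Function.Injective s} ∩ (Set.univ.pi fun _ => Set.Icc 0 3) ∩
    {s | ∀ i j, |s i - s j| ≤ η}

theorem measurableSet_arcTuples (n : ℕ) (η : ℝ) : MeasurableSet (arcTuples n η) := by
  refine ((measurableSet_injective n).inter
    (MeasurableSet.univ_pi fun _ => measurableSet_Icc)).inter ?_
  have : {s : Fin n → ℝ | ∀ i j, |s i - s j| ≤ η} = ⋂ i, ⋂ j, {s | |s i - s j| ≤ η} := by
    ext s
    simp
  rw [this]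
  exact MeasurableSet.iInter fun i => MeasurableSet.iInter fun j =>
    measurableSet_le ((measurable_pi_apply i).sub (measurable_pi_apply j)).abs measurable_const

theorem lintegral_integrand_arcTuples_lt_top {n t : ℕ} (Γ : Tri n t) (φ : Knot) {η : ℝ}
    (hη : η < 1) : ∫⁻ c in arcTuples n η ×ˢ Set.univ, ‖integrand Γ φ c‖ₑ < ∞ := by
  obtain ⟨C, β, hC, hβ, hβ1, hbound⟩ := exists_abs_integrand_le Γ φ hη
  obtain ⟨V, hV, hVle⟩ := exists_lintegral_jacobianSum_le Γ φ
  have hrestrict : (volume : Measure ((Fin n → ℝ) × (Fin t → V3))).restrict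
      (arcTuples n η ×ˢ Set.univ) = (volume.restrict (arcTuples n η)).prod volume := by
    rw [Measure.volume_eq_prod, ← Measure.prod_restrict, Measure.restrict_univ]
  rw [hrestrict, lintegral_prod _ (measurable_integrand Γ φ).enorm.aemeasurable]
  calc _ ≤ ∫⁻ s in arcTuples n η,
        ENNReal.ofReal C * ((∏ k, ENNReal.ofReal (gap s k ^ (-β))) * V) := by
        refine setLIntegral_mono' (measurableSet_arcTuples n η) fun s hs => ?_
        calc _ ≤ ∫⁻ x, ENNReal.ofReal (C * ∏ k, gap s k ^ (-β)) *
              ENNReal.ofReal (Γ.jacobianSum φ s x) := by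
              refine lintegral_mono fun x => ?_
              have hg : 0 ≤ C * ∏ k, gap s k ^ (-β) := mul_nonneg hC
                (Finset.prod_nonneg fun k _ => Real.rpow_nonneg (gap_pos s k).le _)
              rw [← ENNReal.ofReal_mul hg, Real.enorm_eq_ofReal_abs]
              exact ENNReal.ofReal_le_ofReal (hbound s hs.1.1 hs.2 x)
          _ = ENNReal.ofReal (C * ∏ k, gap s k ^ (-β)) *
              ∫⁻ x, ENNReal.ofReal (Γ.jacobianSum φ s x) :=
              lintegral_const_mul' _ _ ENNReal.ofReal_ne_top
          _ ≤ ENNReal.ofReal (C * ∏ k, gap s k ^ (-β)) * V := mul_le_mul_right (hVle s) _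
          _ = _ := by
              rw [ENNReal.ofReal_mul hC, ENNReal.ofReal_prod_of_nonneg fun k _ =>
                Real.rpow_nonneg (gap_pos s k).le _, mul_assoc]
    _ = ENNReal.ofReal C *
        ((∫⁻ s in arcTuples n η, ∏ k, ENNReal.ofReal (gap s k ^ (-β))) * V) := by
        rw [lintegral_const_mul' _ _ ENNReal.ofReal_ne_top, lintegral_mul_const' _ _ hV]
    _ < ∞ := by
        refine ENNReal.mul_lt_top ENNReal.ofReal_lt_top (ENNReal.mul_lt_top ?_ hV.lt_top)
        exact (lintegral_mono_set Set.inter_subset_left).trans_lt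
          (lintegral_prod_gap_rpow_lt_top n hβ hβ1 3)

end

/- STATEMENT 10: convergence of the configuration-space integrals (Bott-Taubes):
for a smooth embedded knot `φ` and a trivalent V-oriented Wilson diagram `Γ`,
the coefficient function `F` of `⋀_{e} φ_e^* ω` with respect to the coordinate
volume element determined by `Ω(Γ, or_Γ)` is Lebesgue-integrable on
`C_{n,t}(φ)`; in particular `I(Γ)(φ)` is a well-defined finite real number. -/
theorem bott_taubes_integrable (n t : ℕ) (Γ : Tri n t) (φ : Knot) :
    MeasureTheory.IntegrableOn (integrand Γ φ) (Config φ n t) := by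
  have hn : (0 : ℝ) < n := by exact_mod_cast Γ.npos
  set A := arcTuples n (1 - 1 / (n : ℝ)) ×ˢ (Set.univ : Set (Fin t → V3))
  let shift (T : Finset (Fin n)) (c : (Fin n → ℝ) × (Fin t → V3)) := c + (periodShift T, 0)
  have hsub : Config φ n t ⊆ ⋃ T, shift T ⁻¹' A := by
    rintro ⟨s, x⟩ ⟨hmono, hlt, hnonneg, hlt1, -⟩
    obtain ⟨i₀, hi₀⟩ := hlt1 Γ.npos.ne'
    obtain ⟨T, hinj, hT⟩ := exists_periodShift s hmono hlt
    refine Set.mem_iUnion.2 ⟨T, ⟨⟨hinj, fun i _ => ?_⟩, hT⟩, Set.mem_univ _⟩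
    have h1 := hlt i i₀
    have h2 := hnonneg i
    simp only [Pi.add_apply, periodShift, shift, Prod.fst_add, Set.mem_Icc] at *
    split_ifs <;> constructor <;> linarith
  refine ⟨(measurable_integrand Γ φ).aestronglyMeasurable, ?_⟩
  rw [MeasureTheory.hasFiniteIntegral_iff_enorm]
  calc _ ≤ ∑' T, ∫⁻ c in shift T ⁻¹' A, ‖integrand Γ φ c‖ₑ :=
        (MeasureTheory.lintegral_mono_set hsub).trans (MeasureTheory.lintegral_iUnion_le _ _)
    _ = ∑' _T : Finset (Fin n), ∫⁻ c in A, ‖integrand Γ φ c‖ₑ := by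
        refine tsum_congr fun T => ?_
        have hinv : (MeasureTheory.volume :
            MeasureTheory.Measure ((Fin n → ℝ) × (Fin t → V3))).IsAddLeftInvariant :=
          MeasureTheory.Measure.prod.instIsAddLeftInvariant
        rw [← (MeasureTheory.measurePreserving_add_right MeasureTheory.volume
          ((periodShift T, 0) : (Fin n → ℝ) × (Fin t → V3))).setLIntegral_comp_preimage_emb
          (measurableEmbedding_addRight _) _ A]
        simp only [integrand_add_periodShift]
        rfl
    _ < _ := by
        rw [tsum_fintype]
        exact ENNReal.sum_lt_top.2 fun _ _ =>
          lintegral_integrand_arcTuples_lt_top Γ φ (by linarith [one_div_pos.2 hn])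
end

section
/- Let φ : S¹ → ℝ³ be a smooth embedding and φ* = −φ its mirror image (composition with x ↦ −x). Let Γ be a trivalent V-oriented Wilson graph of degree N (n external and t internal vertices, N = (n+t)/2). Then the configuration-space integrals satisfy I(Γ)(φ*) = (−1)^N · I(Γ)(φ). -/
/-- The reflection `(s, x) ↦ (s, -x)` of the internal vertices of a configuration. -/
def reflectInternal (n t : ℕ) :
    (Fin n → ℝ) × (Fin t → V3) ≃ᵐ (Fin n → ℝ) × (Fin t → V3) :=
  (MeasurableEquiv.refl _).prodCongr (MeasurableEquiv.neg _)

theorem reflectInternal_apply {n t : ℕ} (c : (Fin n → ℝ) × (Fin t → V3)) :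
    reflectInternal n t c = (c.1, -c.2) := rfl

theorem measurePreserving_reflectInternal (n t : ℕ) :
    MeasureTheory.MeasurePreserving (reflectInternal n t) :=
  (MeasureTheory.MeasurePreserving.id _).prod (MeasureTheory.Measure.measurePreserving_neg _)

/-- The sign by which reflecting the internal vertices acts on the coordinates of a vertex. -/
def reflectSign {n t : ℕ} : Fin n ⊕ Fin t → ℝ
  | .inl _ => 1
  | .inr _ => -1

theorem prod_reflectSign (n t : ℕ) :
    ∏ p : (v : Fin n ⊕ Fin t) × Fin (triBound n t v), reflectSign p.1 = (-1) ^ t := by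
  rw [Fintype.prod_sigma]
  simp only [Finset.prod_const, Finset.card_univ, Fintype.card_fin]
  simp [triBound, reflectSign, Odd.neg_one_pow (by decide : Odd 3)]

theorem Tri.card_edges_mul_two {n t : ℕ} (Γ : Tri n t) :
    Fintype.card Γ.E * 2 = n + 3 * t := by
  have h := Fintype.card_congr Γ.anch
  rw [Fintype.card_prod, Fintype.card_bool, Fintype.card_sigma] at h
  simp only [Fintype.card_fin] at h
  simpa [triBound, mul_comm t] using h

theorem gauss2_neg_smul (x a b : V3) (r s : ℝ) :
    gauss2 (-x) (r • a) (s • b) = -(r * s) * gauss2 x a b := by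
  have hdot : dot3 (-x) (-x) = dot3 x x := by simp [dot3]
  have hdet : dot3 (-x) (cross3 (r • a) (s • b)) = -(r * s) * dot3 x (cross3 a b) := by
    simp [dot3, cross3]
    ring
  rw [gauss2, gauss2, hdot, hdet, mul_div_assoc]

section Mirror

variable {n t : ℕ} {φ ψ : Knot}

theorem posOf_mirror (hmir : ∀ s, ψ.map s = -φ.map s)
    (c : (Fin n → ℝ) × (Fin t → V3)) (v : Fin n ⊕ Fin t) :
    posOf ψ (reflectInternal n t c) v = -posOf φ c v := by
  cases v <;> simp [posOf, reflectInternal_apply, hmir]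

theorem dposOf_mirror_bvec (hmir : ∀ s, ψ.map s = -φ.map s)
    (c : (Fin n → ℝ) × (Fin t → V3))
    (p : (v : Fin n ⊕ Fin t) × Fin (triBound n t v)) (v : Fin n ⊕ Fin t) :
    dposOf ψ (reflectInternal n t c) (bvec p) v =
      -reflectSign p.1 • dposOf φ c (bvec p) v := by
  have hmap : ψ.map = -φ.map := funext hmir
  rcases p with ⟨i | j, k⟩ <;> cases v <;>
    simp [dposOf, bvec, reflectSign, reflectInternal_apply, hmap, deriv.neg]

theorem preimage_reflectInternal_config (hmir : ∀ s, ψ.map s = -φ.map s) :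
    reflectInternal n t ⁻¹' Config ψ n t = Config φ n t := by
  ext c
  simp [Config, reflectInternal_apply, hmir, Function.Injective]

theorem integrand_mirror (Γ : Tri n t) (hmir : ∀ s, ψ.map s = -φ.map s)
    (c : (Fin n → ℝ) × (Fin t → V3)) :
    integrand Γ ψ (reflectInternal n t c) =
      (-1) ^ (Fintype.card Γ.E + t) * integrand Γ φ c := by
  have hsign (τ : Γ.E × Bool ≃ (v : Fin n ⊕ Fin t) × Fin (triBound n t v)) :
      ∏ e, (reflectSign (τ (e, false)).1 * reflectSign (τ (e, true)).1) = (-1) ^ t := by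
    rw [← prod_reflectSign n t, ← Equiv.prod_comp τ, Fintype.prod_prod_type]
    simp [mul_comm]
  unfold integrand
  rw [Finset.mul_sum]
  refine Finset.sum_congr rfl fun τ _ ↦ ?_
  have hpos (u v : Fin n ⊕ Fin t) :
      posOf ψ (reflectInternal n t c) u - posOf ψ (reflectInternal n t c) v =
        -(posOf φ c u - posOf φ c v) := by
    rw [posOf_mirror hmir, posOf_mirror hmir, neg_sub_neg, neg_sub]
  simp only [hpos, dposOf_mirror_bvec hmir, ← smul_sub, gauss2_neg_smul, neg_mul_neg]
  rw [Finset.prod_mul_distrib, Finset.prod_neg, hsign, Finset.card_univ, pow_add]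
  ring

end Mirror

/- STATEMENT 11: behaviour under mirror image: if `φ* = -φ` is the mirror image
of the knot `φ` and `Γ` is a trivalent V-oriented Wilson diagram of degree `N`
(`n + t = 2N`), then `I(Γ)(φ*) = (-1)^N · I(Γ)(φ)`. -/
theorem mirror_image_integral (n t N : ℕ) (hdeg : n + t = 2 * N)
    (Γ : Tri n t) (φ ψ : Knot) (hmir : ∀ s : ℝ, ψ.map s = -(φ.map s)) :
    Itri Γ ψ = (-1 : ℝ) ^ N * Itri Γ φ := by
  have hcard : Fintype.card Γ.E + t = N + 2 * t := by
    have := Γ.card_edges_mul_two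
    omega
  calc Itri Γ ψ
      = ∫ c in Config φ n t, integrand Γ ψ (reflectInternal n t c) := by
        rw [← preimage_reflectInternal_config hmir, Itri,
          (measurePreserving_reflectInternal n t).setIntegral_preimage_emb
            (reflectInternal n t).measurableEmbedding]
    _ = (-1 : ℝ) ^ N * Itri Γ φ := by
        simp only [integrand_mirror Γ hmir, MeasureTheory.integral_const_mul, Itri, hcard,
          pow_add, pow_mul, neg_one_sq, one_pow, mul_one]
end

section
/- Let φ : S¹ → ℝ³ be a smooth embedding and φ̄ the same knot with reversed orientation, φ̄(s) = φ(−s). Let Γ be a trivalent V-oriented Wilson graph with n external vertices, and Γ̄ the same V-oriented graph with the orientation of its Wilson line reversed. Then the configuration-space integrals satisfy I(Γ)(φ̄) = (−1)^n · I(Γ̄)(φ). -/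
/- STATEMENT 12: behaviour under orientation reversal of the knot. -/

/-- `Γ'` is `Γ` with the orientation of its Wilson line reversed (same graph and
V-orientation; the cyclic labelling of the external vertices is reversed). -/
def IsReversal {n t : ℕ} (Γ Γ' : Tri n t) : Prop :=
  ∃ ψ : Γ.E ≃ Γ'.E, ∀ (e : Γ.E) (b : Bool),
    Γ'.ep (ψ e) b = Sum.map Fin.rev id (Γ.ep e b) ∧
    Γ'.cmp (ψ e) b = Γ.cmp e b

open MeasureTheory

/-- the bijection of configuration coordinates induced by reversing the labels of the
external vertices. -/
def coordRev (n t : ℕ) : Equiv.Perm ((v : Fin n ⊕ Fin t) × Fin (triBound n t v)) where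
  toFun
    | ⟨.inl i, c⟩ => ⟨.inl i.rev, c⟩
    | ⟨.inr j, c⟩ => ⟨.inr j, c⟩
  invFun
    | ⟨.inl i, c⟩ => ⟨.inl i.rev, c⟩
    | ⟨.inr j, c⟩ => ⟨.inr j, c⟩
  left_inv := by
    rintro ⟨i | j, c⟩
    · exact Sigma.ext (congrArg Sum.inl i.rev_rev) HEq.rfl
    · rfl
  right_inv := by
    rintro ⟨i | j, c⟩
    · exact Sigma.ext (congrArg Sum.inl i.rev_rev) HEq.rfl
    · rfl

/-- the factor by which the coordinate direction at a vertex is scaled by knot reversal. -/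
def vertexSign {n t : ℕ} : Fin n ⊕ Fin t → ℝ := Sum.elim (fun _ => -1) (fun _ => 1)

/-- the map on configurations reversing the knot parameters and their labels. -/
def configRev {n t : ℕ} (c : (Fin n → ℝ) × (Fin t → V3)) : (Fin n → ℝ) × (Fin t → V3) :=
  (fun i => -c.1 i.rev, c.2)

/-- the diagonal translation of the knot parameters by one period. -/
def periodVec (n t : ℕ) : (Fin n → ℝ) × (Fin t → V3) := (fun _ => 1, 0)

/-- the union of all the lifts of `Config φ n t` to real knot parameters. -/
def liftedConfig (φ : Knot) (n t : ℕ) : Set ((Fin n → ℝ) × (Fin t → V3)) :=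
  {c | StrictMono c.1 ∧ (∀ i j : Fin n, c.1 i < c.1 j + 1) ∧ Function.Injective c.2 ∧
       (∀ (i : Fin n) (j : Fin t), φ.map (c.1 i) ≠ c.2 j)}

theorem coordRev_fst {n t : ℕ} (p : (v : Fin n ⊕ Fin t) × Fin (triBound n t v)) :
    (coordRev n t p).1 = Sum.map Fin.rev id p.1 := by
  obtain ⟨i | j, c⟩ := p <;> rfl

theorem coordRev_snd_val {n t : ℕ} (p : (v : Fin n ⊕ Fin t) × Fin (triBound n t v)) :
    ((coordRev n t p).2 : ℕ) = (p.2 : ℕ) := by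
  obtain ⟨i | j, c⟩ := p <;> rfl

theorem coord_ext {n t : ℕ} {p q : (v : Fin n ⊕ Fin t) × Fin (triBound n t v)}
    (h₁ : p.1 = q.1) (h₂ : (p.2 : ℕ) = (q.2 : ℕ)) : p = q := by
  obtain ⟨v, a⟩ := p
  obtain ⟨w, b⟩ := q
  obtain rfl : v = w := h₁
  obtain rfl : a = b := Fin.ext h₂
  rfl

theorem prod_vertexSign (n t : ℕ) :
    ∏ p : (v : Fin n ⊕ Fin t) × Fin (triBound n t v), vertexSign p.1 = (-1 : ℝ) ^ n := by
  have h : ∀ v : Fin n ⊕ Fin t, ∏ _ : Fin (triBound n t v), vertexSign v = vertexSign v := by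
    rintro (i | j) <;> rw [Fin.prod_const] <;> simp [triBound, vertexSign]
  rw [Fintype.prod_sigma, Finset.prod_congr rfl fun v _ => h v]
  simp [vertexSign]

theorem gauss2_smul_smul (x u v : V3) (a b : ℝ) :
    gauss2 x (a • u) (b • v) = a * b * gauss2 x u v := by
  simp only [gauss2, dot3, cross3, Pi.smul_apply, smul_eq_mul, Matrix.cons_val_zero,
    Matrix.cons_val_one, Matrix.cons_val]
  ring

section Reversal

variable {n t : ℕ} {φ ψ : Knot}

theorem deriv_reversed (hknot : ∀ s : ℝ, ψ.map s = φ.map (-s)) (s : ℝ) :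
    deriv ψ.map (-s) = -deriv φ.map s := by
  rw [funext hknot, deriv_comp_neg, neg_neg]

theorem posOf_configRev (hknot : ∀ s : ℝ, ψ.map s = φ.map (-s))
    (c : (Fin n → ℝ) × (Fin t → V3)) (v : Fin n ⊕ Fin t) :
    posOf ψ (configRev c) v = posOf φ c (Sum.map Fin.rev id v) := by
  cases v <;> simp [posOf, configRev, hknot]

theorem dposOf_configRev (hknot : ∀ s : ℝ, ψ.map s = φ.map (-s))
    (c : (Fin n → ℝ) × (Fin t → V3)) (p : (v : Fin n ⊕ Fin t) × Fin (triBound n t v))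
    (v : Fin n ⊕ Fin t) :
    dposOf ψ (configRev c) (bvec p) v =
      vertexSign p.1 • dposOf φ c (bvec (coordRev n t p)) (Sum.map Fin.rev id v) := by
  obtain ⟨i | j, a⟩ := p <;> obtain k | k := v
  · by_cases h : k = i <;>
      simp [dposOf, configRev, bvec, coordRev, vertexSign, deriv_reversed hknot, h]
  all_goals simp [dposOf, configRev, bvec, coordRev, vertexSign]

theorem configRev_mem_liftedConfig (hknot : ∀ s : ℝ, ψ.map s = φ.map (-s))
    (c : (Fin n → ℝ) × (Fin t → V3)) :
    configRev c ∈ liftedConfig ψ n t ↔ c ∈ liftedConfig φ n t := by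
  have h₁ : StrictMono (configRev c).1 ↔ StrictMono c.1 := by
    constructor
    · intro h i j hij
      have := h (Fin.rev_lt_rev.2 hij)
      simpa [configRev] using this
    · intro h i j hij
      exact neg_lt_neg (h (Fin.rev_lt_rev.2 hij))
  have h₂ : (∀ i j, (configRev c).1 i < (configRev c).1 j + 1) ↔
      ∀ i j, c.1 i < c.1 j + 1 := by
    constructor
    · intro h i j
      have := h j.rev i.rev
      simp only [configRev, Fin.rev_rev] at this
      linarith
    · intro h i j
      have := h j.rev i.rev
      simp only [configRev]
      linarith
  have h₃ : (∀ i j, ψ.map ((configRev c).1 i) ≠ (configRev c).2 j) ↔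
      ∀ i j, φ.map (c.1 i) ≠ c.2 j := by
    simp only [configRev, hknot, neg_neg]
    exact Fin.revPerm.forall_congr_right (q := fun i => ∀ j, φ.map (c.1 i) ≠ c.2 j)
  exact and_congr h₁ (and_congr h₂ (and_congr Iff.rfl h₃))

theorem anch_of_isReversal {Γ Γ' : Tri n t} {f : Γ.E ≃ Γ'.E}
    (hf : ∀ (e : Γ.E) (b : Bool), Γ'.ep (f e) b = Sum.map Fin.rev id (Γ.ep e b) ∧
      Γ'.cmp (f e) b = Γ.cmp e b) (e : Γ.E) (b : Bool) :
    Γ'.anch (f e, b) = coordRev n t (Γ.anch (e, b)) :=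
  coord_ext ((hf e b).1.trans (coordRev_fst _).symm) ((hf e b).2.trans (coordRev_snd_val _).symm)

theorem integrand_configRev {Γ Γ' : Tri n t} (hrev : IsReversal Γ Γ')
    (hknot : ∀ s : ℝ, ψ.map s = φ.map (-s)) (c : (Fin n → ℝ) × (Fin t → V3)) :
    integrand Γ ψ (configRev c) = (-1 : ℝ) ^ n * integrand Γ' φ c := by
  obtain ⟨f, hf⟩ := hrev
  let F : Γ.E × Bool ≃ Γ'.E × Bool := f.prodCongr (Equiv.refl Bool)
  rw [integrand, integrand, ← (Equiv.equivCongr F (coordRev n t)).sum_comp, Finset.mul_sum]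
  refine Finset.sum_congr rfl fun τ _ => ?_
  have hsign : Equiv.Perm.sign ((Equiv.equivCongr F (coordRev n t) τ).trans Γ'.anch.symm) =
      Equiv.Perm.sign (τ.trans Γ.anch.symm) := by
    rw [← Equiv.Perm.sign_symm_trans_trans (τ.trans Γ.anch.symm) F]
    congr 1
    ext1 x
    simp only [Equiv.equivCongr_apply_apply, Equiv.trans_apply]
    rw [Equiv.symm_apply_eq]
    have hanch : ∀ y, Γ'.anch (F y) = coordRev n t (Γ.anch y) :=
      fun y => anch_of_isReversal hf y.1 y.2
    rw [hanch, Equiv.apply_symm_apply]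
  have hprod : ∏ e : Γ.E, (vertexSign (τ (e, false)).1 * vertexSign (τ (e, true)).1) =
      (-1 : ℝ) ^ n := by
    rw [← prod_vertexSign n t, ← τ.prod_comp, Fintype.prod_prod_type]
    simp [mul_comm]
  rw [hsign, ← hprod, ← f.prod_comp, mul_left_comm, ← Finset.prod_mul_distrib]
  congr 1
  refine Finset.prod_congr rfl fun e _ => ?_
  have hF : ∀ b, F.symm (f e, b) = (e, b) := fun b => by simp [F]
  simp only [posOf_configRev hknot, dposOf_configRev hknot, (hf e _).1, ← smul_sub,
    gauss2_smul_smul, Equiv.equivCongr_apply_apply, hF]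

end Reversal

section Translation

variable {n t : ℕ} (φ : Knot)

theorem Knot.map_add_int (k : ℤ) (s : ℝ) : φ.map (k + s) = φ.map s := by
  rw [add_comm]
  simpa using φ.periodic.int_mul k s

theorem Knot.deriv_add_int (k : ℤ) (s : ℝ) : deriv φ.map (k + s) = deriv φ.map s := by
  rw [← deriv_comp_const_add, funext (φ.map_add_int k)]

theorem zsmul_periodVec_add_fst (k : ℤ) (c : (Fin n → ℝ) × (Fin t → V3)) (i : Fin n) :
    (k • periodVec n t + c).1 i = k + c.1 i := by
  simp [periodVec]

theorem zsmul_periodVec_add_snd (k : ℤ) (c : (Fin n → ℝ) × (Fin t → V3)) :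
    (k • periodVec n t + c).2 = c.2 := by
  simp [periodVec]

theorem integrand_zsmul_periodVec_add (Γ : Tri n t) (k : ℤ) (c : (Fin n → ℝ) × (Fin t → V3)) :
    integrand Γ φ (k • periodVec n t + c) = integrand Γ φ c := by
  have hpos : ∀ v, posOf φ (k • periodVec n t + c) v = posOf φ c v := by
    rintro (i | j)
    · simp only [posOf, zsmul_periodVec_add_fst, φ.map_add_int]
    · simp only [posOf, zsmul_periodVec_add_snd]
  have hdpos : ∀ w v, dposOf φ (k • periodVec n t + c) w v = dposOf φ c w v := by
    rintro w (i | j)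
    · simp only [dposOf, zsmul_periodVec_add_fst, φ.deriv_add_int]
    · simp only [dposOf]
  simp only [integrand, hpos, hdpos]

theorem zsmul_periodVec_add_mem_liftedConfig (k : ℤ) (c : (Fin n → ℝ) × (Fin t → V3)) :
    k • periodVec n t + c ∈ liftedConfig φ n t ↔ c ∈ liftedConfig φ n t := by
  simp only [liftedConfig, Set.mem_ofPred_eq, StrictMono, zsmul_periodVec_add_fst,
    zsmul_periodVec_add_snd, φ.map_add_int, add_assoc, add_lt_add_iff_left]

theorem measurableSet_liftedConfig : MeasurableSet (liftedConfig φ n t) := by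
  have hφ := φ.smooth.continuous
  have h₁ : IsOpen {c : (Fin n → ℝ) × (Fin t → V3) | StrictMono c.1} := by
    simp only [StrictMono, Set.ofPred_forall]
    exact isOpen_iInter_of_finite fun i => isOpen_iInter_of_finite fun j =>
      isOpen_iInter_of_finite fun _ => isOpen_lt (by fun_prop) (by fun_prop)
  have h₂ : IsOpen {c : (Fin n → ℝ) × (Fin t → V3) | ∀ i j : Fin n, c.1 i < c.1 j + 1} := by
    simp only [Set.ofPred_forall]
    exact isOpen_iInter_of_finite fun i => isOpen_iInter_of_finite fun j =>
      isOpen_lt (by fun_prop) (by fun_prop)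
  have h₃ : IsOpen {c : (Fin n → ℝ) × (Fin t → V3) | Function.Injective c.2} := by
    simp only [Function.Injective, ← not_imp_not (b := _ = _), ← ne_eq, Set.ofPred_forall]
    exact isOpen_iInter_of_finite fun i => isOpen_iInter_of_finite fun j =>
      isOpen_iInter_of_finite fun _ => isOpen_ne_fun (by fun_prop) (by fun_prop)
  have h₄ : IsOpen {c : (Fin n → ℝ) × (Fin t → V3) |
      ∀ (i : Fin n) (j : Fin t), φ.map (c.1 i) ≠ c.2 j} := by
    simp only [Set.ofPred_forall]
    exact isOpen_iInter_of_finite fun i => isOpen_iInter_of_finite fun j =>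
      isOpen_ne_fun (by fun_prop) (by fun_prop)
  exact (h₁.inter (h₂.inter (h₃.inter h₄))).measurableSet

/-- A measurable set of configurations met exactly once by each orbit of the diagonal integer
translations is a fundamental domain for them. -/
theorem isAddFundamentalDomain_zmultiples_periodVec
    {s : Set ((Fin n → ℝ) × (Fin t → V3))} (hs : MeasurableSet s)
    (h : ∀ c, ∃! k : ℤ, k • periodVec n t + c ∈ s) :
    IsAddFundamentalDomain (AddSubgroup.zmultiples (periodVec n t)) s volume := by
  refine IsAddFundamentalDomain.mk' hs.nullMeasurableSet fun c => ?_
  obtain ⟨k, hk, huniq⟩ := h c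
  refine ⟨⟨k • periodVec n t, k, rfl⟩, hk, ?_⟩
  rintro ⟨_, l, rfl⟩ hl
  obtain rfl := huniq l hl
  rfl

theorem Config_eq_inter (i : Fin n) (hi : ∀ j, i ≤ j) :
    Config φ n t = {c | c.1 i ∈ Set.Ico 0 1} ∩ liftedConfig φ n t := by
  ext c
  constructor
  · rintro ⟨hmono, hlt, hnonneg, hex, hinj, hne⟩
    obtain ⟨j, hj⟩ := hex i.pos.ne'
    exact ⟨⟨hnonneg i, (hmono.monotone (hi j)).trans_lt hj⟩, hmono, hlt, hinj, hne⟩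
  · rintro ⟨⟨h0, h1⟩, hmono, hlt, hinj, hne⟩
    exact ⟨hmono, hlt, fun j => h0.trans (hmono.monotone (hi j)), fun _ => ⟨i, h1⟩, hinj, hne⟩

theorem Itri_eq_setIntegral_indicator (Γ : Tri n t) (i : Fin n) (hi : ∀ j, i ≤ j) :
    Itri Γ φ = ∫ c in {c : (Fin n → ℝ) × (Fin t → V3) | c.1 i ∈ Set.Ico 0 1},
      (liftedConfig φ n t).indicator (integrand Γ φ) c := by
  rw [setIntegral_indicator (measurableSet_liftedConfig φ), ← Config_eq_inter φ i hi, Itri]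

end Translation

theorem configRev_configRev {n t : ℕ} (c : (Fin n → ℝ) × (Fin t → V3)) :
    configRev (configRev c) = c := by
  simp [configRev]

theorem measurePreserving_configRev (n t : ℕ) :
    MeasurePreserving (configRev : (Fin n → ℝ) × (Fin t → V3) → _) := by
  have h := (Measure.measurePreserving_neg (volume : Measure (Fin n → ℝ))).comp
    (volume_preserving_arrowCongr' (Fin.revPerm (n := n)) (MeasurableEquiv.refl ℝ)
      (MeasurePreserving.id volume))
  exact h.prod (MeasurePreserving.id (volume : Measure (Fin t → V3)))

theorem measurableEmbedding_configRev (n t : ℕ) :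
    MeasurableEmbedding (configRev : (Fin n → ℝ) × (Fin t → V3) → _) :=
  MeasurableEquiv.measurableEmbedding
    { toFun := configRev
      invFun := configRev
      left_inv := configRev_configRev
      right_inv := configRev_configRev
      measurable_toFun := (measurePreserving_configRev n t).measurable
      measurable_invFun := (measurePreserving_configRev n t).measurable }

/- If `φ̄(s) = φ(-s)` is the knot with the opposite orientation and `Γ̄` is the
V-oriented Wilson graph `Γ` with the orientation of its Wilson line reversed,
then `I(Γ)(φ̄) = (-1)^n · I(Γ̄)(φ)`, `n` the number of external vertices. -/
theorem orientation_reversal_integral (n t : ℕ) (Γ Γ' : Tri n t)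
    (hrev : IsReversal Γ Γ') (φ ψ : Knot)
    (hknot : ∀ s : ℝ, ψ.map s = φ.map (-s)) :
    Itri Γ ψ = (-1 : ℝ) ^ n * Itri Γ' φ := by
  have hn : 0 < n := Γ.npos
  let i : Fin n := ⟨0, hn⟩
  have hi : ∀ j, i ≤ j := fun j => Nat.zero_le _
  let F := (liftedConfig φ n t).indicator (integrand Γ' φ)
  let D : Set ((Fin n → ℝ) × (Fin t → V3)) := {c | c.1 i ∈ Set.Ico 0 1}
  have hDmeas : MeasurableSet D :=
    measurableSet_Ico.preimage ((measurable_pi_apply i).comp measurable_fst)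
  have hD : IsAddFundamentalDomain (AddSubgroup.zmultiples (periodVec n t)) D volume := by
    refine isAddFundamentalDomain_zmultiples_periodVec hDmeas fun c => ?_
    have := existsUnique_add_zsmul_mem_Ico (one_pos : (0 : ℝ) < 1) (c.1 i) 0
    simpa only [D, Set.mem_ofPred_eq, zsmul_periodVec_add_fst, zsmul_one, zero_add,
      add_comm (c.1 i)] using this
  have hD' : IsAddFundamentalDomain (AddSubgroup.zmultiples (periodVec n t))
      (configRev ⁻¹' D) volume := by
    refine isAddFundamentalDomain_zmultiples_periodVec
      (hDmeas.preimage (measurePreserving_configRev n t).measurable) fun c => ?_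
    have := existsUnique_sub_zsmul_mem_Ico (one_pos : (0 : ℝ) < 1) (-c.1 i.rev) 0
    simpa only [D, Set.mem_preimage, configRev, Set.mem_ofPred_eq, zsmul_periodVec_add_fst,
      zsmul_one, zero_add, neg_add_rev, ← sub_eq_add_neg] using this
  have hF : ∀ (g : AddSubgroup.zmultiples (periodVec n t)) c, F (g +ᵥ c) = F c := by
    rintro ⟨_, k, rfl⟩ c
    change F (k • periodVec n t + c) = F c
    have hmem := zsmul_periodVec_add_mem_liftedConfig φ k c
    by_cases hc : c ∈ liftedConfig φ n t
    · simp only [F, Set.indicator_of_mem hc, Set.indicator_of_mem (hmem.2 hc),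
        integrand_zsmul_periodVec_add]
    · simp only [F, Set.indicator_of_notMem hc, Set.indicator_of_notMem (mt hmem.1 hc)]
  have hcomp : ∀ c, (liftedConfig ψ n t).indicator (integrand Γ ψ) (configRev c) =
      (-1 : ℝ) ^ n * F c := fun c => by
    have hmem := configRev_mem_liftedConfig hknot c
    by_cases hc : c ∈ liftedConfig φ n t
    · simp only [F, Set.indicator_of_mem hc, Set.indicator_of_mem (hmem.2 hc),
        integrand_configRev hrev hknot]
    · simp only [F, Set.indicator_of_notMem hc, Set.indicator_of_notMem (mt hmem.1 hc), mul_zero]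
  have : (volume : Measure ((Fin n → ℝ) × (Fin t → V3))).IsAddLeftInvariant :=
    Measure.prod.instIsAddLeftInvariant (μ := volume) (ν := volume)
  have : VAddInvariantMeasure (AddSubgroup.zmultiples (periodVec n t))
      ((Fin n → ℝ) × (Fin t → V3)) volume :=
    ⟨fun g s _ => measure_preimage_add volume (g : (Fin n → ℝ) × (Fin t → V3)) s⟩
  rw [Itri_eq_setIntegral_indicator ψ Γ i hi, Itri_eq_setIntegral_indicator φ Γ' i hi,
    ← (measurePreserving_configRev n t).setIntegral_preimage_emb
      (measurableEmbedding_configRev n t), ← integral_const_mul]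
  simp only [hcomp]
  rw [integral_const_mul, integral_const_mul]
  exact congrArg _ (hD'.setIntegral_eq hD hF)
end
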